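/- arXiv:0902.0065 — 3 statements merged into one kernel-verified Lean document; each statement's English description precedes it below -/
import Mathlib

section
/- Let λ > 0 and let f : (0,∞) → ℝ be a C^∞ function such that the quantities F^{[λ]}_{n,k}(x) = (−1)^n Σ_{j=0}^{k} binom(k,j) (Γ(n+k+λ)/Γ(n+j+λ)) x^j f^{(n+j)}(x) are nonnegative for all integers n, k ≥ 0 and all x > 0. Then f is a generalized Stieltjes function of order λ, i.e. there exist a constant C ≥ 0 and a nonnegative Borel measure ρ on [0,∞) with ∫_{[0,∞)} (x+t)^{-λ} dρ(t) < ∞ for all x > 0 such that f(x) = C + ∫_{[0,∞)} (x+t)^{-λ} dρ(t) for all x > 0. -/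
open MeasureTheory Set Filter

/-- `f` is a generalized Stieltjes function of order `λ`. -/
def IsGenStieltjes (lam : ℝ) (f : ℝ → ℝ) : Prop :=
  ∃ (C : ℝ) (ρ : Measure ℝ), 0 ≤ C ∧ ρ (Set.Iio 0) = 0 ∧
    (∀ x > (0 : ℝ), Integrable (fun t => (x + t) ^ (-lam)) ρ) ∧
    ∀ x > (0 : ℝ), f x = C + ∫ t, (x + t) ^ (-lam) ∂ρ

/-- `F^{[λ]}_{n,k}(x) = (−1)^n Σ_{j=0}^{k} C(k,j) (Γ(n+k+λ)/Γ(n+j+λ)) x^j f^{(n+j)}(x)`. -/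
noncomputable def Fgen (lam : ℝ) (f : ℝ → ℝ) (n k : ℕ) (x : ℝ) : ℝ :=
  (-1 : ℝ) ^ n * ∑ j ∈ Finset.range (k + 1),
    (k.choose j : ℝ) * (Real.Gamma ((n : ℝ) + k + lam) / Real.Gamma ((n : ℝ) + j + lam)) *
      x ^ j * iteratedDerivWithin (n + j) f (Set.Ioi 0) x

open scoped ENNReal NNReal Topology

/-- A sequence of functions on `(0, ∞)`, each of which is nonnegative and minus the derivative of
which is the next one; `G 0` is then completely monotone. -/
structure IsCMChain (G : ℕ → ℝ → ℝ) : Prop where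
  measurable : ∀ j, Measurable (G j)
  nonneg : ∀ j, ∀ x > (0 : ℝ), 0 ≤ G j x
  hasDerivAt : ∀ j, ∀ x > (0 : ℝ), HasDerivAt (G j) (-G (j + 1) x) x

namespace IsCMChain

variable {G : ℕ → ℝ → ℝ}

lemma shift (hG : IsCMChain G) : IsCMChain fun j => G (j + 1) :=
  ⟨fun _ => hG.measurable _, fun _ => hG.nonneg _, fun _ => hG.hasDerivAt _⟩

lemma indicator {G : ℕ → ℝ → ℝ} (h0 : ∀ j, ∀ x > (0 : ℝ), 0 ≤ G j x)
    (h1 : ∀ j, ∀ x > (0 : ℝ), HasDerivAt (G j) (-G (j + 1) x) x) :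
    IsCMChain fun j => (Ioi (0 : ℝ)).indicator (G j) where
  measurable j := by
    have hc : ContinuousOn (G j) (Ioi 0) := fun x hx =>
      (h1 j x hx).continuousAt.continuousWithinAt
    rw [← Set.piecewise_eq_indicator]
    exact hc.measurable_piecewise continuousOn_const measurableSet_Ioi
  nonneg j x hx := by simpa [Set.indicator, hx] using h0 j x hx
  hasDerivAt j x hx := by
    rw [Set.indicator_of_mem (mem_Ioi.2 hx)]
    refine (h1 j x hx).congr_of_eventuallyEq ?_
    filter_upwards [Ioi_mem_nhds hx] with y hy
    exact Set.indicator_of_mem hy _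

lemma antitoneOn (hG : IsCMChain G) (j : ℕ) : AntitoneOn (G j) (Ioi 0) := by
  refine antitoneOn_of_deriv_nonpos (convex_Ioi 0)
    (fun x hx => (hG.hasDerivAt j x hx).continuousAt.continuousWithinAt)
    (fun x hx => ?_) (fun x hx => ?_)
  · rw [interior_Ioi] at hx
    exact (hG.hasDerivAt j x hx).differentiableAt.differentiableWithinAt
  · rw [interior_Ioi] at hx
    rw [(hG.hasDerivAt j x hx).deriv]
    exact neg_nonpos.2 (hG.nonneg _ x hx)

lemma exists_tendsto (hG : IsCMChain G) : ∃ c, 0 ≤ c ∧ Tendsto (G 0) atTop (𝓝 c) := by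
  have hanti : Antitone fun x => G 0 (max x 1) := fun x y hxy =>
    hG.antitoneOn 0 (mem_Ioi.2 (lt_max_of_lt_right one_pos)) (mem_Ioi.2 (lt_max_of_lt_right one_pos))
      (max_le_max hxy le_rfl)
  have hnn : ∀ x : ℝ, 0 ≤ G 0 (max x 1) := fun x =>
    hG.nonneg 0 _ (lt_max_of_lt_right one_pos)
  have hbdd : BddBelow (range fun x => G 0 (max x 1)) := ⟨0, by rintro _ ⟨x, rfl⟩; exact hnn x⟩
  refine ⟨_, le_ciInf hnn, (tendsto_atTop_ciInf hanti hbdd).congr' ?_⟩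
  filter_upwards [eventually_ge_atTop 1] with x hx
  rw [max_eq_left hx]

lemma eq_add_lintegral_one (hG : IsCMChain G) {c : ℝ} (hc : Tendsto (G 0) atTop (𝓝 c)) {x : ℝ}
    (hx : 0 < x) :
    ENNReal.ofReal (G 0 x) = ENNReal.ofReal c + ∫⁻ y in Ioi x, ENNReal.ofReal (G 1 y) := by
  have hd : ∀ y ∈ Ici x, HasDerivAt (G 0) (-G 1 y) y := fun y hy =>
    hG.hasDerivAt 0 y (hx.trans_le hy)
  have hn : ∀ y ∈ Ioi x, -G 1 y ≤ 0 := fun y hy => neg_nonpos.2 (hG.nonneg 1 y (hx.trans hy))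
  have hi := integrableOn_Ioi_deriv_of_nonpos' hd hn hc
  have he := integral_Ioi_of_hasDerivAt_of_nonpos' hd hn hc
  have hi' : IntegrableOn (G 1) (Ioi x) := by simpa using hi.neg
  have hae : 0 ≤ᵐ[volume.restrict (Ioi x)] G 1 := by
    filter_upwards [ae_restrict_mem measurableSet_Ioi] with y hy
    exact hG.nonneg 1 y (hx.trans hy)
  have hc0 : 0 ≤ c := ge_of_tendsto hc (by
    filter_upwards [eventually_gt_atTop 0] with y hy using hG.nonneg 0 y hy)
  rw [← ofReal_integral_eq_lintegral_ofReal hi' hae,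
    ← ENNReal.ofReal_add hc0 (integral_nonneg_of_ae hae)]
  congr 1
  rw [integral_neg] at he
  linarith

lemma lintegral_Ioi_lintegral_Ioi (x : ℝ) {k : ℝ → ℝ → ℝ≥0∞}
    (hk : Measurable (Function.uncurry k)) :
    ∫⁻ y in Ioi x, ∫⁻ z in Ioi y, k y z = ∫⁻ z in Ioi x, ∫⁻ y in Ioo x z, k y z := by
  have h : ∀ y z, (Ioi x).indicator (fun y => (Ioi y).indicator (k y) z) y =
      (Ioi x).indicator (fun z => (Ioo x z).indicator (fun y => k y z) y) z := by
    intro y z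
    simp only [Set.indicator, mem_Ioi, mem_Ioo]
    grind
  have h1 : ∀ y, (Ioi x).indicator (fun y => ∫⁻ z in Ioi y, k y z) y =
      ∫⁻ z, (Ioi x).indicator (fun y => (Ioi y).indicator (k y) z) y := by
    intro y
    by_cases hy : y ∈ Ioi x
    · rw [Set.indicator_of_mem hy, ← lintegral_indicator measurableSet_Ioi]
      simp only [Set.indicator_of_mem hy]
    · simp [Set.indicator_of_notMem hy]
  have h2 : ∀ z, (Ioi x).indicator (fun z => ∫⁻ y in Ioo x z, k y z) z =
      ∫⁻ y, (Ioi x).indicator (fun z => (Ioo x z).indicator (fun y => k y z) y) z := by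
    intro z
    by_cases hz : z ∈ Ioi x
    · rw [Set.indicator_of_mem hz, ← lintegral_indicator measurableSet_Ioo]
      simp only [Set.indicator_of_mem hz]
    · simp [Set.indicator_of_notMem hz]
  rw [← lintegral_indicator measurableSet_Ioi, ← lintegral_indicator measurableSet_Ioi]
  simp_rw [h1, h2, ← h]
  refine lintegral_lintegral_swap (Measurable.aemeasurable ?_)
  have : (Function.uncurry fun y z => (Ioi x).indicator (fun y => (Ioi y).indicator (k y) z) y) =
      {p : ℝ × ℝ | x < p.1 ∧ p.1 < p.2}.indicator (Function.uncurry k) := by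
    ext ⟨y, z⟩
    simp only [Function.uncurry, Set.indicator, mem_Ioi, mem_ofPred_eq]
    grind
  rw [this]
  exact hk.indicator ((measurableSet_lt measurable_const measurable_fst).inter
    (measurableSet_lt measurable_fst measurable_snd))

lemma lintegral_sub_pow_div_factorial {x z : ℝ} (hxz : x ≤ z) (N : ℕ) :
    ∫⁻ y in Ioo x z, ENNReal.ofReal ((z - y) ^ N / N.factorial) =
      ENNReal.ofReal ((z - x) ^ (N + 1) / (N + 1).factorial) := by
  rw [restrict_Ioo_eq_restrict_Ioc, ← ofReal_integral_eq_lintegral_ofReal,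
    ← intervalIntegral.integral_of_le hxz]
  · congr 1
    rw [intervalIntegral.integral_comp_sub_left (fun y => y ^ N / (N.factorial : ℝ)) z]
    rw [intervalIntegral.integral_div, integral_pow, Nat.factorial_succ]
    push_cast
    field_simp
    simp
  · exact ((by fun_prop : Continuous fun y : ℝ => (z - y) ^ N / (N.factorial : ℝ)).integrableOn_Icc
      (a := x) (b := z)).mono_set Ioc_subset_Icc_self
  · filter_upwards [ae_restrict_mem measurableSet_Ioc] with y hy
    have := sub_nonneg.2 hy.2
    simp only [Pi.zero_apply]
    positivity

/-- Taylor's formula at infinity with integral remainder. -/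
theorem eq_add_lintegral (N : ℕ) {G : ℕ → ℝ → ℝ} (hG : IsCMChain G) {c : ℝ}
    (hc : Tendsto (G 0) atTop (𝓝 c)) {x : ℝ} (hx : 0 < x) :
    ENNReal.ofReal (G 0 x) = ENNReal.ofReal c +
      ∫⁻ y in Ioi x, ENNReal.ofReal ((y - x) ^ N / N.factorial) * ENNReal.ofReal (G (N + 1) y) := by
  induction N generalizing G c x with
  | zero => simpa using hG.eq_add_lintegral_one hc hx
  | succ N ih =>
    obtain ⟨c', hc'0, hc'⟩ := hG.shift.exists_tendsto
    have h1 := hG.eq_add_lintegral_one hc hx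
    have h2 := fun (y : ℝ) (hy : 0 < y) => ih hG.shift hc' hy
    have hc'z : c' = 0 := by
      by_contra hne
      have hpos : 0 < c' := lt_of_le_of_ne hc'0 (Ne.symm hne)
      have hle : ∫⁻ y in Ioi x, ENNReal.ofReal c' ≤ ∫⁻ y in Ioi x, ENNReal.ofReal (G 1 y) := by
        refine setLIntegral_mono' measurableSet_Ioi fun y hy => ?_
        have := h2 y (hx.trans hy)
        simp only [zero_add] at this
        rw [this]
        exact le_self_add
      rw [setLIntegral_const, Real.volume_Ioi,
        ENNReal.mul_top (ENNReal.ofReal_pos.2 hpos).ne', top_le_iff] at hle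
      rw [hle, add_top] at h1
      exact ENNReal.ofReal_ne_top h1
    rw [h1]
    congr 1
    calc ∫⁻ y in Ioi x, ENNReal.ofReal (G 1 y)
        = ∫⁻ y in Ioi x, ∫⁻ z in Ioi y,
          ENNReal.ofReal ((z - y) ^ N / N.factorial) * ENNReal.ofReal (G (N + 2) z) := by
          refine setLIntegral_congr_fun measurableSet_Ioi fun y hy => ?_
          have := h2 y (hx.trans hy)
          simp only [zero_add, hc'z, ENNReal.ofReal_zero] at this
          exact this
      _ = ∫⁻ z in Ioi x, ∫⁻ y in Ioo x z,
          ENNReal.ofReal ((z - y) ^ N / N.factorial) * ENNReal.ofReal (G (N + 2) z) := by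
          refine lintegral_Ioi_lintegral_Ioi x ?_
          have := hG.measurable (N + 2)
          unfold Function.uncurry
          fun_prop
      _ = _ := by
          refine setLIntegral_congr_fun measurableSet_Ioi fun z hz => ?_
          rw [lintegral_mul_const _ (by fun_prop), lintegral_sub_pow_div_factorial (le_of_lt hz)]

end IsCMChain

section Fgen

variable {lam : ℝ} {f : ℝ → ℝ}

lemma hasDerivAt_iteratedDerivWithin_Ioi (hf : ContDiffOn ℝ (⊤ : ℕ∞) f (Ioi 0)) (m : ℕ) {x : ℝ}
    (hx : 0 < x) :
    HasDerivAt (iteratedDerivWithin m f (Ioi 0)) (iteratedDerivWithin (m + 1) f (Ioi 0) x) x := by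
  have h := (hf.differentiableOn_iteratedDerivWithin (m := m)
    (by exact_mod_cast WithTop.coe_lt_top _) (uniqueDiffOn_Ioi 0)) x hx
  rw [iteratedDerivWithin_succ]
  exact h.hasDerivWithinAt.hasDerivAt (Ioi_mem_nhds hx)

lemma Fgen_zero_right (hlam : 0 < lam) (n : ℕ) :
    Fgen lam f n 0 = fun x => (-1) ^ n * iteratedDerivWithin n f (Ioi 0) x := by
  ext x
  have : Real.Gamma (n + lam) ≠ 0 := (Real.Gamma_pos_of_pos (by positivity)).ne'
  simp [Fgen, this]

lemma hasDerivAt_Fgen_zero_right (hlam : 0 < lam) (hf : ContDiffOn ℝ (⊤ : ℕ∞) f (Ioi 0)) (n : ℕ)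
    {x : ℝ} (hx : 0 < x) :
    HasDerivAt (Fgen lam f n 0) (-Fgen lam f (n + 1) 0 x) x := by
  rw [Fgen_zero_right hlam, Fgen_zero_right hlam]
  refine ((hasDerivAt_iteratedDerivWithin_Ioi hf n hx).const_mul ((-1) ^ n)).congr_deriv ?_
  ring

/-- The recursion of the coefficients of `Fgen`, with `a = n + λ`. -/
lemma choose_mul_Gamma_div_succ {a : ℝ} (ha : 0 < a) (k j : ℕ) :
    ((k + 1).choose (j + 1) : ℝ) *
        (Real.Gamma (a + (k + 1 : ℕ)) / Real.Gamma (a + (j + 1 : ℕ))) =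
      (a + k + (j + 1 : ℕ)) *
        ((k.choose (j + 1) : ℝ) * (Real.Gamma (a + k) / Real.Gamma (a + (j + 1 : ℕ)))) +
      (k.choose j : ℝ) * (Real.Gamma (a + k) / Real.Gamma (a + j)) := by
  have hk : Real.Gamma (a + (k + 1 : ℕ)) = (a + k) * Real.Gamma (a + k) := by
    rw [← Real.Gamma_add_one (by positivity)]; push_cast; ring_nf
  have hj : Real.Gamma (a + (j + 1 : ℕ)) = (a + j) * Real.Gamma (a + j) := by
    rw [← Real.Gamma_add_one (by positivity)]; push_cast; ring_nf
  have hne : Real.Gamma (a + j) ≠ 0 := (Real.Gamma_pos_of_pos (by positivity)).ne'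
  have haj : a + j ≠ 0 := by positivity
  have hch : (k.choose (j + 1) : ℝ) * (j + 1) = k.choose j * (k - j) := by
    rcases le_or_gt j k with h | h
    · have := Nat.choose_succ_right_eq k j
      rw [← Nat.cast_sub h]
      exact_mod_cast this
    · simp [Nat.choose_eq_zero_of_lt h, Nat.choose_eq_zero_of_lt (h.trans (Nat.lt_succ_self j))]
  rw [hk, hj, Nat.choose_succ_succ]
  push_cast
  field_simp
  linear_combination (-1 : ℝ) * hch

lemma hasDerivAt_Fgen (hlam : 0 < lam) (hf : ContDiffOn ℝ (⊤ : ℕ∞) f (Ioi 0)) (n k : ℕ)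
    {x : ℝ} (hx : 0 < x) :
    HasDerivAt (Fgen lam f n k)
      ((Fgen lam f n (k + 1) x - (n + k + lam) * Fgen lam f n k x) / x) x := by
  set D : ℕ → ℝ → ℝ := fun m => iteratedDerivWithin m f (Ioi 0) with hD
  set c : ℕ → ℕ → ℝ := fun k j =>
    (k.choose j : ℝ) * (Real.Gamma (n + k + lam) / Real.Gamma (n + j + lam)) with hc
  have ha : 0 < (n : ℝ) + lam := by positivity
  have hF : ∀ k y, Fgen lam f n k y =
      (-1) ^ n * ∑ j ∈ Finset.range (k + 1), c k j * (y ^ j * D (n + j) y) := by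
    intro k y
    simp only [Fgen, hc, hD, mul_assoc]
  have hrec : ∀ j, c (k + 1) (j + 1) = (n + k + lam + (j + 1 : ℕ)) * c k (j + 1) + c k j := by
    intro j
    have := choose_mul_Gamma_div_succ ha k j
    simp only [hc]
    convert this using 3 <;> ring_nf
  have hrec0 : c (k + 1) 0 = (n + k + lam) * c k 0 := by
    have : (n : ℝ) + (k + 1 : ℕ) + lam = (n + k + lam) + 1 := by push_cast; ring
    simp only [hc, this]
    rw [Real.Gamma_add_one (by positivity)]
    simp
    ring
  have hlast : c k (k + 1) = 0 := by simp [hc]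
  have hder : HasDerivAt (Fgen lam f n k) ((-1) ^ n * ∑ j ∈ Finset.range (k + 1),
      c k j * ((j : ℝ) * x ^ (j - 1) * D (n + j) x + x ^ j * D (n + j + 1) x)) x := by
    rw [show Fgen lam f n k = _ from funext (hF k)]
    refine HasDerivAt.const_mul _ (HasDerivAt.fun_sum fun j _ => HasDerivAt.const_mul _ ?_)
    exact (hasDerivAt_pow j x).mul (hasDerivAt_iteratedDerivWithin_Ioi hf (n + j) hx)
  refine hder.congr_deriv (Eq.symm ?_)
  rw [div_eq_iff hx.ne', hF, hF]
  have hpow : ∀ j : ℕ, (j : ℝ) * x ^ (j - 1) * x = j * x ^ j := by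
    intro j
    cases j with
    | zero => simp
    | succ j => simp [pow_succ]; ring
  have hR : (∑ j ∈ Finset.range (k + 1),
      c k j * ((j : ℝ) * x ^ (j - 1) * D (n + j) x + x ^ j * D (n + j + 1) x)) * x =
      ∑ j ∈ Finset.range (k + 1), (j : ℝ) * c k j * (x ^ j * D (n + j) x) +
      ∑ j ∈ Finset.range (k + 1), c k j * (x ^ (j + 1) * D (n + (j + 1)) x) := by
    rw [Finset.sum_mul, ← Finset.sum_add_distrib]
    refine Finset.sum_congr rfl fun j _ => ?_
    rw [← add_assoc]
    linear_combination c k j * D (n + j) x * hpow j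
  have hS : ∑ j ∈ Finset.range (k + 1 + 1), c (k + 1) j * (x ^ j * D (n + j) x) =
      ∑ j ∈ Finset.range (k + 1), (n + k + lam + j) * c k j * (x ^ j * D (n + j) x) +
      ∑ j ∈ Finset.range (k + 1), c k j * (x ^ (j + 1) * D (n + (j + 1)) x) := by
    have hT : ∑ j ∈ Finset.range (k + 1), (n + k + lam + j) * c k j * (x ^ j * D (n + j) x) =
        ∑ j ∈ Finset.range (k + 1 + 1), (n + k + lam + j) * c k j * (x ^ j * D (n + j) x) := by
      rw [Finset.sum_range_succ _ (k + 1), hlast]; ring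
    rw [hT, Finset.sum_range_succ', Finset.sum_range_succ' _ (k + 1), hrec0]
    have hA : ∑ j ∈ Finset.range (k + 1), c (k + 1) (j + 1) * (x ^ (j + 1) * D (n + (j + 1)) x) =
        ∑ j ∈ Finset.range (k + 1),
          (n + k + lam + (j + 1 : ℕ)) * c k (j + 1) * (x ^ (j + 1) * D (n + (j + 1)) x) +
        ∑ j ∈ Finset.range (k + 1), c k j * (x ^ (j + 1) * D (n + (j + 1)) x) := by
      rw [← Finset.sum_add_distrib]
      refine Finset.sum_congr rfl fun j _ => ?_
      rw [hrec]; ring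
    rw [hA]
    push_cast
    ring
  have hsplit : ∑ j ∈ Finset.range (k + 1), (n + k + lam + j) * c k j * (x ^ j * D (n + j) x) =
      (n + k + lam) * ∑ j ∈ Finset.range (k + 1), c k j * (x ^ j * D (n + j) x) +
      ∑ j ∈ Finset.range (k + 1), (j : ℝ) * c k j * (x ^ j * D (n + j) x) := by
    rw [Finset.mul_sum, ← Finset.sum_add_distrib]
    exact Finset.sum_congr rfl fun j _ => by ring
  rw [mul_assoc, hR, hS, hsplit]
  ring

lemma isCMChain_Fgen_zero_right (hlam : 0 < lam) (hf : ContDiffOn ℝ (⊤ : ℕ∞) f (Ioi 0))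
    (hF : ∀ (n k : ℕ), ∀ x > (0 : ℝ), 0 ≤ Fgen lam f n k x) :
    IsCMChain fun n => (Ioi 0).indicator (Fgen lam f n 0) :=
  IsCMChain.indicator (fun n => hF n 0) fun n _ hx => hasDerivAt_Fgen_zero_right hlam hf n hx

/-- `s ↦ (-1)ⁿ s^{-(n+λ)} f⁽ⁿ⁾(1/s)` is completely monotone. -/
lemma isCMChain_rpow_mul_Fgen_inv (hlam : 0 < lam) (hf : ContDiffOn ℝ (⊤ : ℕ∞) f (Ioi 0))
    (hF : ∀ (n k : ℕ), ∀ x > (0 : ℝ), 0 ≤ Fgen lam f n k x) (n : ℕ) :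
    IsCMChain fun k => (Ioi 0).indicator fun s => s ^ (-(n + k + lam)) * Fgen lam f n k s⁻¹ := by
  refine IsCMChain.indicator (fun k s hs => ?_) fun k s hs => ?_
  · exact mul_nonneg (Real.rpow_nonneg (le_of_lt hs) _) (hF n k _ (inv_pos.2 hs))
  · have hs' : (0 : ℝ) < s := hs
    have h1 := Real.hasDerivAt_rpow_const (x := s) (p := -(n + k + lam)) (Or.inl hs'.ne')
    have h2 := (hasDerivAt_Fgen hlam hf n k (inv_pos.2 hs')).comp s (hasDerivAt_inv hs'.ne')
    have e1 : s ^ (-((n : ℝ) + k + lam) - 1) = s ^ (-((n : ℝ) + k + lam)) * s⁻¹ := by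
      rw [Real.rpow_sub_one hs'.ne', div_eq_mul_inv]
    have e2 : s ^ (-((n : ℝ) + (k + 1 : ℕ) + lam)) = s ^ (-((n : ℝ) + k + lam)) * s⁻¹ := by
      rw [← e1]; congr 1; push_cast; ring
    refine (h1.mul h2).congr_deriv ?_
    simp only [Function.comp_apply]
    rw [e1, e2]
    field_simp
    ring

end Fgen

section Kernel

/-- The truncated power `(1 - u)₊ ^ N`. -/
noncomputable def truncPow (N : ℕ) (u : ℝ) : ℝ := max 0 (1 - u) ^ N

@[fun_prop]
lemma continuous_truncPow (N : ℕ) : Continuous (truncPow N) := by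
  unfold truncPow; fun_prop

lemma truncPow_nonneg (N : ℕ) (u : ℝ) : 0 ≤ truncPow N u := by
  unfold truncPow; positivity

lemma truncPow_of_le_one {u : ℝ} (N : ℕ) (hu : u ≤ 1) : truncPow N u = (1 - u) ^ N := by
  rw [truncPow, max_eq_right (by linarith)]

lemma truncPow_of_one_le {u : ℝ} {N : ℕ} (hN : N ≠ 0) (hu : 1 ≤ u) : truncPow N u = 0 := by
  rw [truncPow, max_eq_left (by linarith), zero_pow hN]

lemma truncPow_le_exp (N : ℕ) (u : ℝ) : truncPow N u ≤ Real.exp (-(N * u)) := by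
  rw [truncPow, ← mul_neg, Real.exp_nat_mul]
  refine pow_le_pow_left₀ (le_max_left _ _) (max_le (Real.exp_nonneg _) ?_) N
  linarith [Real.add_one_le_exp (-u)]

lemma truncPow_mul_le_exp (N : ℕ) (u v : ℝ) :
    truncPow N u * truncPow N v ≤ Real.exp (-(N * (u + v))) := by
  rw [mul_add, neg_add, Real.exp_add]
  exact mul_le_mul (truncPow_le_exp N u) (truncPow_le_exp N v) (truncPow_nonneg N v)
    (Real.exp_nonneg _)

lemma truncPow_add_le_mul (N : ℕ) {u v : ℝ} (hu : 0 ≤ u) (hv : 0 ≤ v) :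
    truncPow N (u + v) ≤ truncPow N u * truncPow N v := by
  rw [truncPow, truncPow, truncPow, ← mul_pow]
  refine pow_le_pow_left₀ (le_max_left _ _) (max_le (by positivity) ?_) N
  rcases le_total u 1 with h | h
  · rcases le_total v 1 with h' | h'
    · rw [max_eq_right (by linarith), max_eq_right (by linarith)]
      nlinarith
    · have : 0 ≤ max 0 (1 - u) * max 0 (1 - v) := by positivity
      linarith
  · have : 0 ≤ max 0 (1 - u) * max 0 (1 - v) := by positivity
    linarith

lemma tendsto_truncPow_div (u : ℝ) :
    Tendsto (fun N : ℕ => truncPow N (u / N)) atTop (𝓝 (Real.exp (-u))) := by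
  refine (Real.tendsto_one_add_div_pow_exp (-u)).congr' ?_
  filter_upwards [eventually_ge_atTop (max 1 ⌈u⌉₊)] with N hN
  have h1 : (1 : ℝ) ≤ N := by exact_mod_cast (le_max_left _ _).trans hN
  have h2 : u ≤ N := (Nat.le_ceil u).trans (by exact_mod_cast (le_max_right _ _).trans hN)
  rw [truncPow_of_le_one _ ((div_le_one (by linarith)).2 h2)]
  ring

lemma lintegral_Ioi_comp_const_div_mul_rpow {lam : ℝ} (hlam : lam ≠ 0) (φ : ℝ → ℝ≥0∞)
    {c : ℝ} (hc : 0 < c) :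
    ∫⁻ y in Ioi 0, φ (c / y) * ENNReal.ofReal (y ^ (-1 - lam)) =
      ENNReal.ofReal (c ^ (-lam)) *
        ∫⁻ z in Ioi 0, φ z⁻¹ * ENNReal.ofReal (z ^ (-1 - lam)) := by
  have himg : (fun z : ℝ => c * z) '' Ioi 0 = Ioi 0 := by
    simp [Set.image_mul_left_Ioi hc]
  rw [← lintegral_const_mul' _ _ ENNReal.ofReal_ne_top]
  conv_lhs => rw [← himg]
  rw [lintegral_image_eq_lintegral_abs_deriv_mul (f' := fun _ => c) measurableSet_Ioi
    (fun z _ => by simpa using ((hasDerivAt_id z).const_mul c).hasDerivWithinAt)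
    (fun a _ b _ h => mul_left_cancel₀ hc.ne' h)]
  refine setLIntegral_congr_fun measurableSet_Ioi fun z hz => ?_
  have hz : (0 : ℝ) < z := hz
  have h1 : c / (c * z) = z⁻¹ := by field_simp
  have h2 : c * (c * z) ^ (-1 - lam) = c ^ (-lam) * z ^ (-1 - lam) := by
    rw [Real.mul_rpow hc.le hz.le, ← mul_assoc]
    congr 1
    rw [← Real.rpow_one_add' hc.le]
    · ring_nf
    · ring_nf; exact neg_ne_zero.2 hlam
  simp only [h1, abs_of_pos hc]
  rw [mul_left_comm, ← ENNReal.ofReal_mul hc.le, h2, ENNReal.ofReal_mul (by positivity),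
    mul_left_comm]

lemma lintegral_Ioi_comp_inv_mul_rpow (lam : ℝ) (φ : ℝ → ℝ≥0∞) :
    ∫⁻ z in Ioi 0, φ z⁻¹ * ENNReal.ofReal (z ^ (-1 - lam)) =
      ∫⁻ u in Ioi 0, φ u * ENNReal.ofReal (u ^ (lam - 1)) := by
  have himg : (fun z : ℝ => z⁻¹) '' Ioi 0 = Ioi 0 := by
    ext; simp
  conv_rhs => rw [← himg]
  rw [lintegral_image_eq_lintegral_abs_deriv_mul (f' := fun z => -(z ^ 2)⁻¹) measurableSet_Ioi
    (fun z hz => (hasDerivAt_inv (ne_of_gt hz)).hasDerivWithinAt)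
    (fun a _ b _ h => inv_injective h)]
  refine setLIntegral_congr_fun measurableSet_Ioi fun z hz => ?_
  have hz : (0 : ℝ) < z := hz
  have h2 : z ^ (-1 - lam) = |(-(z ^ 2)⁻¹)| * z⁻¹ ^ (lam - 1) := by
    rw [abs_neg, abs_of_pos (by positivity), Real.inv_rpow hz.le, ← Real.rpow_neg hz.le,
      ← Real.rpow_natCast, ← Real.rpow_neg hz.le, ← Real.rpow_add hz]
    congr 1
    push_cast
    ring
  rw [h2, ENNReal.ofReal_mul (abs_nonneg _), mul_left_comm]

/-- Approximations of `Γ(λ)`. -/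
noncomputable def truncGamma (lam : ℝ) (N : ℕ) : ℝ≥0∞ :=
  ∫⁻ z in Ioi 0, ENNReal.ofReal (truncPow N (z⁻¹ / N)) * ENNReal.ofReal (z ^ (-1 - lam))

lemma lintegral_exp_neg_inv_mul_rpow {lam : ℝ} (hlam : 0 < lam) :
    ∫⁻ z in Ioi 0, ENNReal.ofReal (Real.exp (-z⁻¹)) * ENNReal.ofReal (z ^ (-1 - lam)) =
      ENNReal.ofReal (Real.Gamma lam) := by
  rw [lintegral_Ioi_comp_inv_mul_rpow lam fun u => ENNReal.ofReal (Real.exp (-u)),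
    Real.Gamma_eq_integral hlam, ofReal_integral_eq_lintegral_ofReal
      (Real.GammaIntegral_convergent hlam)]
  · refine setLIntegral_congr_fun measurableSet_Ioi fun u _ => ?_
    rw [ENNReal.ofReal_mul (Real.exp_nonneg _)]
  · filter_upwards [ae_restrict_mem measurableSet_Ioi] with u hu
    have : (0 : ℝ) < u := hu
    simp only [Pi.zero_apply]
    positivity

lemma tendsto_truncGamma {lam : ℝ} (hlam : 0 < lam) :
    Tendsto (truncGamma lam) atTop (𝓝 (ENNReal.ofReal (Real.Gamma lam))) := by
  rw [← lintegral_exp_neg_inv_mul_rpow hlam]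
  refine tendsto_lintegral_filter_of_dominated_convergence'
    (fun z => ENNReal.ofReal (Real.exp (-z⁻¹)) * ENNReal.ofReal (z ^ (-1 - lam)))
    (Eventually.of_forall fun N => by fun_prop) ?_ ?_ ?_
  · filter_upwards [eventually_ne_atTop 0] with N hN
    refine Eventually.of_forall fun z => mul_le_mul_left (ENNReal.ofReal_le_ofReal ?_) _
    refine (truncPow_le_exp _ _).trans_eq ?_
    congr 2
    field_simp
  · rw [lintegral_exp_neg_inv_mul_rpow hlam]
    exact ENNReal.ofReal_ne_top
  · refine Eventually.of_forall fun z => ?_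
    exact ENNReal.Tendsto.mul_const (ENNReal.tendsto_ofReal (tendsto_truncPow_div _))
      (Or.inr ENNReal.ofReal_ne_top)

lemma truncGamma_mul_le_lintegral {lam : ℝ} (hlam : 0 < lam) {N : ℕ} (hN : N ≠ 0) {x t : ℝ}
    (hx : 0 < x) (ht : 0 ≤ t) :
    ENNReal.ofReal ((N * (x + t)) ^ (-lam)) * truncGamma lam N ≤
      ∫⁻ y in Ioi 0, ENNReal.ofReal (truncPow N (x / y)) * ENNReal.ofReal (truncPow N (t / y)) *
        ENNReal.ofReal (y ^ (-1 - lam)) := by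
  have hN' : (0 : ℝ) < N := by positivity
  rw [truncGamma, ← lintegral_Ioi_comp_const_div_mul_rpow hlam.ne'
    (fun u => ENNReal.ofReal (truncPow N (u / N))) (by positivity)]
  refine setLIntegral_mono' measurableSet_Ioi fun y hy => ?_
  have hy : (0 : ℝ) < y := hy
  rw [← ENNReal.ofReal_mul (truncPow_nonneg N (x / y))]
  refine mul_le_mul_left (ENNReal.ofReal_le_ofReal ?_) _
  rw [show N * (x + t) / y / N = x / y + t / y by field_simp]
  exact truncPow_add_le_mul N (by positivity) (by positivity)

lemma lintegral_le_Gamma_mul {lam : ℝ} (hlam : 0 < lam) {N : ℕ} (hN : N ≠ 0) {x t : ℝ}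
    (hx : 0 < x) (ht : 0 ≤ t) :
    ∫⁻ y in Ioi 0, ENNReal.ofReal (truncPow N (x / y)) * ENNReal.ofReal (truncPow N (t / y)) *
        ENNReal.ofReal (y ^ (-1 - lam)) ≤
      ENNReal.ofReal ((N * (x + t)) ^ (-lam)) * ENNReal.ofReal (Real.Gamma lam) := by
  have hN' : (0 : ℝ) < N := by positivity
  rw [← lintegral_exp_neg_inv_mul_rpow hlam, ← lintegral_Ioi_comp_const_div_mul_rpow hlam.ne'
    (fun u => ENNReal.ofReal (Real.exp (-u))) (by positivity)]
  refine setLIntegral_mono' measurableSet_Ioi fun y hy => ?_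
  have hy : (0 : ℝ) < y := hy
  rw [← ENNReal.ofReal_mul (truncPow_nonneg N (x / y))]
  gcongr
  refine (truncPow_mul_le_exp _ _ _).trans_eq ?_
  congr 2
  field_simp

end Kernel

/-- A completely monotone function is a mixture of truncated powers `(1 - s t)₊ ^ N`. -/
lemma IsCMChain.exists_measure_truncPow {G : ℕ → ℝ → ℝ} (hG : IsCMChain G) {N : ℕ} (hN : N ≠ 0) :
    ∃ m : Measure ℝ, SFinite m ∧ m (Iio 0) = 0 ∧ ∀ s > 0,
      ENNReal.ofReal (G 0 s) = ∫⁻ t, ENNReal.ofReal (truncPow N (s * t)) ∂m := by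
  obtain ⟨d, _, hd⟩ := hG.exists_tendsto
  have hmeas := hG.measurable (N + 1)
  set w : ℝ → ℝ≥0∞ := fun u => ENNReal.ofReal (u ^ N / N.factorial) * ENNReal.ofReal (G (N + 1) u)
    with hw
  have hwm : Measurable w := by fun_prop
  refine ⟨ENNReal.ofReal d • Measure.dirac 0 +
    ((volume.restrict (Ioi 0)).withDensity w).map (·⁻¹), inferInstance, ?_, fun s hs => ?_⟩
  · have : (fun u : ℝ => u⁻¹) ⁻¹' Iio 0 = Iio 0 := by ext; simp
    have h0 : ((volume.restrict (Ioi 0)).withDensity w) (Iio (0 : ℝ)) = 0 := by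
      refine withDensity_absolutelyContinuous _ _ ?_
      have he : Iio (0 : ℝ) ∩ Ioi 0 = ∅ :=
        Set.disjoint_iff_inter_eq_empty.1 (Set.disjoint_left.2 fun u hu hu' => lt_asymm (mem_Iio.1 hu) (mem_Ioi.1 hu'))
      rw [Measure.restrict_apply measurableSet_Iio, he, measure_empty]
    simp [Measure.map_apply measurable_inv measurableSet_Iio, this, h0]
  · rw [hG.eq_add_lintegral N hd hs, lintegral_add_measure, lintegral_smul_measure,
      lintegral_dirac, lintegral_map (by fun_prop) measurable_inv,
      lintegral_withDensity_eq_lintegral_mul _ hwm (by fun_prop)]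
    congr 1
    · simp [truncPow_of_le_one]
    · rw [← Ioc_union_Ioi_eq_Ioi hs.le, lintegral_union measurableSet_Ioi
        (Set.disjoint_left.2 fun u hu hu' => absurd hu.2 (not_le.2 hu'))]
      have h0 : ∫⁻ u in Ioc 0 s,
          (w * fun u => ENNReal.ofReal (truncPow N (s * u⁻¹))) u = 0 := by
        refine (setLIntegral_congr_fun measurableSet_Ioc fun u hu => ?_).trans lintegral_zero
        have : 1 ≤ s * u⁻¹ := by
          rw [← div_eq_mul_inv, one_le_div hu.1]; exact hu.2
        simp [truncPow_of_one_le hN this]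
      rw [h0, zero_add]
      refine setLIntegral_congr_fun measurableSet_Ioi fun u hu => ?_
      have hu0 : 0 < u := lt_trans hs hu
      have hle : s * u⁻¹ ≤ 1 := by
        rw [← div_eq_mul_inv, div_le_one hu0]; exact le_of_lt hu
      have hp : (u - s) ^ N / N.factorial = u ^ N / N.factorial * (1 - s * u⁻¹) ^ N := by
        rw [div_mul_eq_mul_div, ← mul_pow]
        congr 2
        field_simp
      rw [Pi.mul_apply, hw]
      rw [truncPow_of_le_one _ hle, hp, ENNReal.ofReal_mul (by positivity)]
      ring

/-- Up to a vanishing relative error, `f` is a constant plus a generalized Stieltjes function. -/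
lemma exists_approx_measure {lam : ℝ} (hlam : 0 < lam) {f : ℝ → ℝ}
    (hf : ContDiffOn ℝ (⊤ : ℕ∞) f (Ioi 0))
    (hF : ∀ (n k : ℕ), ∀ x > (0 : ℝ), 0 ≤ Fgen lam f n k x) :
    ∃ c, 0 ≤ c ∧ ∀ N : ℕ, N ≠ 0 → ∃ ρ : Measure ℝ, ρ (Iio 0) = 0 ∧ ∀ x > 0,
      ENNReal.ofReal (f x) ≤ ENNReal.ofReal c + ∫⁻ t, ENNReal.ofReal ((x + t) ^ (-lam)) ∂ρ ∧
      ENNReal.ofReal c + truncGamma lam N / ENNReal.ofReal (Real.Gamma lam) *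
        ∫⁻ t, ENNReal.ofReal ((x + t) ^ (-lam)) ∂ρ ≤ ENNReal.ofReal (f x) := by
  have hG := isCMChain_Fgen_zero_right hlam hf hF
  obtain ⟨c, hc0, hc⟩ := hG.exists_tendsto
  refine ⟨c, hc0, fun N hN => ?_⟩
  obtain ⟨m, hm, hm0, hrep⟩ :=
    (isCMChain_rpow_mul_Fgen_inv hlam hf hF (N + 1)).exists_measure_truncPow hN
  have hmae : ∀ᵐ t ∂m, 0 ≤ t := by
    rw [ae_iff]
    simpa [Iio, not_le] using hm0
  set g : ℝ≥0∞ := ENNReal.ofReal (Real.Gamma lam) with hg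
  have hg0 : g ≠ 0 := (ENNReal.ofReal_pos.2 (Real.Gamma_pos_of_pos hlam)).ne'
  have hgt : g ≠ ⊤ := ENNReal.ofReal_ne_top
  set a : ℝ≥0∞ := ENNReal.ofReal ((N : ℝ) ^ (-lam) / N.factorial) with ha
  have hfx : ∀ x > 0, ENNReal.ofReal (f x) = ENNReal.ofReal c +
      ENNReal.ofReal (1 / N.factorial) * ∫⁻ t, (∫⁻ y in Ioi 0,
        ENNReal.ofReal (truncPow N (x / y)) * ENNReal.ofReal (truncPow N (t / y)) *
          ENNReal.ofReal (y ^ (-1 - lam))) ∂m := by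
    intro x hx
    have h0 := hG.eq_add_lintegral N hc hx
    have hfx0 : (Ioi (0 : ℝ)).indicator (Fgen lam f 0 0) x = f x := by
      rw [Set.indicator_of_mem (mem_Ioi.2 hx), Fgen_zero_right hlam]
      simp
    rw [hfx0] at h0
    rw [h0, lintegral_lintegral_swap (by fun_prop), ← lintegral_const_mul' _ _ ENNReal.ofReal_ne_top]
    congr 1
    have hpt : ∀ y ∈ Ioi (0 : ℝ), ENNReal.ofReal (1 / N.factorial) *
        ∫⁻ t, ENNReal.ofReal (truncPow N (x / y)) * ENNReal.ofReal (truncPow N (t / y)) *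
          ENNReal.ofReal (y ^ (-1 - lam)) ∂m =
        ENNReal.ofReal (1 / N.factorial * (truncPow N (x / y) * y ^ (-1 - lam))) *
          ∫⁻ t, ENNReal.ofReal (truncPow N (y⁻¹ * t)) ∂m := by
      intro y hy
      rw [ENNReal.ofReal_mul (by positivity), mul_assoc, ENNReal.ofReal_mul (truncPow_nonneg _ _),
        ← lintegral_const_mul' _ _ (ENNReal.mul_ne_top ENNReal.ofReal_ne_top ENNReal.ofReal_ne_top)]
      congr 1
      refine lintegral_congr fun t => ?_
      rw [div_eq_inv_mul t y]
      ring
    refine Eq.trans ?_ (setLIntegral_congr_fun measurableSet_Ioi hpt).symm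
    conv_rhs => rw [← Ioc_union_Ioi_eq_Ioi (le_of_lt hx), lintegral_union measurableSet_Ioi
      (Set.disjoint_left.2 fun u hu hu' => absurd hu.2 (not_le.2 hu'))]
    have hz : ∫⁻ y in Ioc 0 x,
        ENNReal.ofReal (1 / N.factorial * (truncPow N (x / y) * y ^ (-1 - lam))) *
          ∫⁻ t, ENNReal.ofReal (truncPow N (y⁻¹ * t)) ∂m = 0 := by
      refine (setLIntegral_congr_fun measurableSet_Ioc fun y hy => ?_).trans lintegral_zero
      rw [truncPow_of_one_le hN ((one_le_div hy.1).2 hy.2)]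
      simp
    rw [hz, zero_add]
    refine setLIntegral_congr_fun measurableSet_Ioi fun y hy => ?_
    have hy0 : 0 < y := lt_trans hx hy
    have hr := hrep y⁻¹ (inv_pos.2 hy0)
    rw [Set.indicator_of_mem (mem_Ioi.2 (inv_pos.2 hy0)), inv_inv] at hr
    rw [← hr, Set.indicator_of_mem (mem_Ioi.2 hy0), truncPow_of_le_one N
      ((div_le_one hy0).2 (le_of_lt hy)), ← ENNReal.ofReal_mul, ← ENNReal.ofReal_mul]
    · congr 1
      have e1 : (y⁻¹ : ℝ) ^ (-(((N + 1 : ℕ) : ℝ) + (0 : ℕ) + lam)) = y ^ N * y ^ (1 + lam) := by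
        rw [Real.inv_rpow hy0.le, ← Real.rpow_neg hy0.le, ← Real.rpow_natCast,
          ← Real.rpow_add hy0]
        congr 1
        push_cast
        ring
      have e2 : y ^ (-1 - lam) * y ^ (1 + lam) = 1 := by
        rw [← Real.rpow_add hy0]; simp
      have e3 : (y - x) ^ N = (1 - x / y) ^ N * y ^ N := by
        rw [← mul_pow]
        congr 1
        field_simp
      rw [e1, e3]
      linear_combination -(1 / N.factorial * (1 - x / y) ^ N * y ^ N *
        Fgen lam f (N + 1) 0 y) * e2
    · have : 0 ≤ 1 - x / y := by
        rw [sub_nonneg, div_le_one hy0]; exact le_of_lt hy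
      positivity
    · have : 0 ≤ y - x := sub_nonneg.2 (le_of_lt hy)
      positivity
  have hab : ∀ x > 0, ∀ t ≥ 0, ENNReal.ofReal ((N * (x + t)) ^ (-lam)) =
      ENNReal.ofReal ((N : ℝ) ^ (-lam)) * ENNReal.ofReal ((x + t) ^ (-lam)) := by
    intro x hx t ht
    rw [Real.mul_rpow (by positivity) (by positivity), ENNReal.ofReal_mul (by positivity)]
  have haa : a = ENNReal.ofReal (1 / N.factorial) * ENNReal.ofReal ((N : ℝ) ^ (-lam)) := by
    rw [ha, ← ENNReal.ofReal_mul (by positivity)]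
    congr 1
    ring
  refine ⟨(a * g) • m, by simp [hm0], fun x hx => ?_⟩
  rw [hfx x hx, lintegral_smul_measure]
  constructor
  · refine add_le_add le_rfl ?_
    calc _ ≤ ENNReal.ofReal (1 / N.factorial) *
          ∫⁻ t, (ENNReal.ofReal ((N : ℝ) ^ (-lam)) * g) * ENNReal.ofReal ((x + t) ^ (-lam)) ∂m := by
          refine mul_le_mul' le_rfl ?_
          refine lintegral_mono_ae ?_
          filter_upwards [hmae] with t ht
          refine (lintegral_le_Gamma_mul hlam hN hx ht).trans_eq ?_
          rw [hab x hx t ht]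
          ring
      _ = _ := by
          rw [lintegral_const_mul' _ _ (ENNReal.mul_ne_top ENNReal.ofReal_ne_top hgt), haa,
            smul_eq_mul]
          ring
  · refine add_le_add le_rfl ?_
    calc truncGamma lam N / g * ((a * g) • ∫⁻ t, ENNReal.ofReal ((x + t) ^ (-lam)) ∂m)
        = ENNReal.ofReal (1 / N.factorial) * (ENNReal.ofReal ((N : ℝ) ^ (-lam)) *
            truncGamma lam N * ∫⁻ t, ENNReal.ofReal ((x + t) ^ (-lam)) ∂m) := by
          rw [haa, smul_eq_mul]
          have : truncGamma lam N / g * g = truncGamma lam N := ENNReal.div_mul_cancel hg0 hgt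
          conv_rhs => rw [← this]
          ring
      _ ≤ _ := by
          refine mul_le_mul' le_rfl ?_
          rw [← lintegral_const_mul _ (by fun_prop)]
          refine lintegral_mono_ae ?_
          filter_upwards [hmae] with t ht
          refine le_trans (le_of_eq ?_) (truncGamma_mul_le_lintegral hlam hN hx ht)
          rw [hab x hx t ht]
          ring

/-- Finite measures of convergent mass on a compact Hausdorff space have a weak cluster point. -/
lemma exists_isFiniteMeasure_of_tendsto_lintegral {X : Type*} [TopologicalSpace X] [CompactSpace X]
    [T2Space X] [MeasurableSpace X] [BorelSpace X] [Nonempty X]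
    (σ : ℕ → Measure X) {L : ℝ≥0∞} (hL : L ≠ ⊤)
    (hσ : Tendsto (fun n => σ n univ) atTop (𝓝 L)) :
    ∃ μ : Measure X, IsFiniteMeasure μ ∧ ∀ ψ : C(X, ℝ≥0), ∀ l : ℝ≥0∞,
      Tendsto (fun n => ∫⁻ t, ψ t ∂σ n) atTop (𝓝 l) → ∫⁻ t, ψ t ∂μ = l := by
  have hfin : ∀ᶠ n in atTop, IsFiniteMeasure (σ n) := by
    filter_upwards [hσ.eventually_lt_const (lt_top_iff_ne_top.2 hL)] with n hn
    exact ⟨hn⟩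
  classical
  let τ : ℕ → FiniteMeasure X := fun n =>
    if h : IsFiniteMeasure (σ n) then ⟨σ n, h⟩ else 0
  have hτ : ∀ᶠ n in atTop, (τ n : Measure X) = σ n := by
    filter_upwards [hfin] with n hn
    simp [τ, hn]
  let 𝒰 := Filter.hyperfilter ℕ
  have h𝒰 : (𝒰 : Filter ℕ) ≤ atTop := Nat.hyperfilter_le_atTop
  obtain ⟨P, -, hP⟩ := isCompact_univ.ultrafilter_le_nhds
    (𝒰.map fun n => (τ n).normalize) (by simp)
  have hP' : Tendsto (fun n => (τ n).normalize) 𝒰 (𝓝 P) := hP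
  refine ⟨L • (P : Measure X), Measure.smul_finite _ hL, fun ψ l hl => ?_⟩
  let ψ' : BoundedContinuousFunction X ℝ≥0 := BoundedContinuousFunction.mkOfCompact ψ
  have h1 := (ProbabilityMeasure.tendsto_iff_forall_lintegral_tendsto.1 hP') ψ'
  have h2 : ∫⁻ t, ψ' t ∂(P : Measure X) ≠ ⊤ :=
    (BoundedContinuousFunction.lintegral_lt_top_of_nnreal (P : Measure X) ψ').ne
  have h3 := ENNReal.Tendsto.mul (hσ.mono_left h𝒰) (Or.inr h2) h1 (Or.inr hL)
  rw [lintegral_smul_measure, smul_eq_mul]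
  refine tendsto_nhds_unique (f := fun n => ∫⁻ t, ψ t ∂σ n) (l := (𝒰 : Filter ℕ)) ?_
    (hl.mono_left h𝒰)
  refine h3.congr' ?_
  filter_upwards [h𝒰 hτ] with n hn
  have h4 : (σ n) univ = ((τ n).mass : ℝ≥0∞) := by
    rw [← hn]; simp
  have h5 : ∫⁻ t, ψ t ∂(σ n) = ∫⁻ t, ψ t ∂((τ n : FiniteMeasure X) : Measure X) := by rw [hn]
  rw [h5, h4]
  conv_rhs => rw [(τ n).self_eq_mass_smul_normalize]
  rw [FiniteMeasure.toMeasure_smul]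
  rw [lintegral_smul_measure]
  rfl

section UnitInterval

open unitInterval

lemma one_add_sub_one_mul_pos {x : ℝ} (hx : 0 < x) (θ : I) : 0 < 1 + (x - 1) * (θ : ℝ) := by
  have h0 := θ.2.1
  have h1 := θ.2.2
  rcases h1.lt_or_eq with h | h
  · nlinarith
  · rw [h]; linarith

/-- The Stieltjes kernel `(x + t) ^ (-λ) / (1 + t) ^ (-λ)` in the variable `θ = (1 + t)⁻¹`. -/
noncomputable def unitKernel (lam : ℝ) {x : ℝ} (hx : 0 < x) : C(I, ℝ≥0) where
  toFun θ := Real.toNNReal ((1 + (x - 1) * (θ : ℝ)) ^ (-lam))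
  continuous_toFun := continuous_real_toNNReal.comp <|
    Continuous.rpow_const (by fun_prop) fun θ => Or.inl (one_add_sub_one_mul_pos hx θ).ne'

lemma coe_unitKernel (lam : ℝ) {x : ℝ} (hx : 0 < x) (θ : I) :
    (unitKernel lam hx θ : ℝ≥0∞) = ENNReal.ofReal ((1 + (x - 1) * (θ : ℝ)) ^ (-lam)) := rfl

/-- Transport of a measure on `[0, ∞)` to `[0, 1]`. -/
lemma exists_measure_unitInterval (lam : ℝ) {ρ : Measure ℝ} (hρ : ρ (Iio 0) = 0) :
    ∃ μ : Measure I, ∀ (x : ℝ) (hx : 0 < x),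
      ∫⁻ θ, unitKernel lam hx θ ∂μ = ∫⁻ t, ENNReal.ofReal ((x + t) ^ (-lam)) ∂ρ := by
  have hρae : ∀ᵐ t ∂ρ, 0 ≤ t := by
    rw [ae_iff]
    simpa [Iio, not_le] using hρ
  have hp : Measurable fun t : ℝ => projIcc (0 : ℝ) 1 zero_le_one (1 + t)⁻¹ :=
    continuous_projIcc.measurable.comp (by fun_prop)
  refine ⟨(ρ.withDensity fun t => ENNReal.ofReal ((1 + t) ^ (-lam))).map
    fun t => projIcc (0 : ℝ) 1 zero_le_one (1 + t)⁻¹, fun x hx => ?_⟩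
  have hk : Measurable fun θ : I => (unitKernel lam hx θ : ℝ≥0∞) :=
    ((unitKernel lam hx).continuous.measurable).coe_nnreal_ennreal
  have hkp : Measurable fun t : ℝ =>
      (unitKernel lam hx (projIcc (0 : ℝ) 1 zero_le_one (1 + t)⁻¹) : ℝ≥0∞) := hk.comp hp
  rw [lintegral_map hk hp, lintegral_withDensity_eq_lintegral_mul _ (by fun_prop) hkp]
  refine lintegral_congr_ae ?_
  filter_upwards [hρae] with t ht
  have hmem : (1 + t)⁻¹ ∈ Icc (0 : ℝ) 1 :=
    ⟨by positivity, inv_le_one_of_one_le₀ (by linarith)⟩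
  rw [Pi.mul_apply, coe_unitKernel, projIcc_of_mem _ hmem, ← ENNReal.ofReal_mul (by positivity)]
  congr 1
  rw [← Real.mul_rpow (by positivity) (one_add_sub_one_mul_pos hx ⟨_, hmem⟩).le]
  congr 1
  have : 1 + t ≠ 0 := by positivity
  field_simp
  ring

/-- A measure on `[0, 1]` gives back a measure on `[0, ∞)` and a constant, namely the mass
of the point `0`, which corresponds to `t = ∞`. -/
lemma exists_measure_of_unitInterval (lam : ℝ) (μ : Measure I) :
    ∃ ρ : Measure ℝ, ρ (Iio 0) = 0 ∧ ∀ (x : ℝ) (hx : 0 < x),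
      ∫⁻ θ, unitKernel lam hx θ ∂μ = μ {0} + ∫⁻ t, ENNReal.ofReal ((x + t) ^ (-lam)) ∂ρ := by
  have hp : Measurable fun θ : I => (θ : ℝ)⁻¹ - 1 := by fun_prop
  refine ⟨((μ.restrict {0}ᶜ).withDensity fun θ : I => ENNReal.ofReal ((θ : ℝ) ^ (-lam))).map
    fun θ : I => (θ : ℝ)⁻¹ - 1, ?_, fun x hx => ?_⟩
  · rw [Measure.map_apply hp measurableSet_Iio]
    refine withDensity_absolutelyContinuous _ _ ?_
    have he : (fun θ : I => (θ : ℝ)⁻¹ - 1) ⁻¹' Iio 0 ∩ {0}ᶜ = ∅ := by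
      refine Set.disjoint_iff_inter_eq_empty.1 (Set.disjoint_left.2 fun θ hθ hθ' => ?_)
      have hpos : 0 < (θ : ℝ) := unitInterval.pos_iff_ne_zero.2 hθ'
      have : 1 ≤ (θ : ℝ)⁻¹ := (one_le_inv₀ hpos).2 θ.2.2
      have h2 : (θ : ℝ)⁻¹ - 1 < 0 := hθ
      linarith
    rw [Measure.restrict_apply (hp measurableSet_Iio), he, measure_empty]
  · have hk : Measurable fun t : ℝ => ENNReal.ofReal ((x + t) ^ (-lam)) := by fun_prop
    have hkp : Measurable fun θ : I => ENNReal.ofReal ((x + ((θ : ℝ)⁻¹ - 1)) ^ (-lam)) := by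
      fun_prop
    have hw : Measurable fun θ : I => ENNReal.ofReal ((θ : ℝ) ^ (-lam)) := by fun_prop
    rw [lintegral_map hk hp, lintegral_withDensity_eq_lintegral_mul _ hw hkp,
      ← lintegral_add_compl _ (measurableSet_singleton (0 : I))]
    congr 1
    · simp [coe_unitKernel]
    · refine setLIntegral_congr_fun (measurableSet_singleton _).compl fun θ hθ => ?_
      have hpos : 0 < (θ : ℝ) := unitInterval.pos_iff_ne_zero.2 hθ
      have : 1 ≤ (θ : ℝ)⁻¹ := (one_le_inv₀ hpos).2 θ.2.2
      rw [coe_unitKernel, Pi.mul_apply, ← ENNReal.ofReal_mul (by positivity),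
        ← Real.mul_rpow hpos.le (by linarith)]
      congr 2
      field_simp
      ring

end UnitInterval

/-- if `f` is `C^∞` on `(0,∞)` and all the quantities `F^{[λ]}_{n,k}(x)` are
nonnegative, then `f` is a generalized Stieltjes function of order `λ`. -/
theorem stmt2 (lam : ℝ) (hlam : 0 < lam) (f : ℝ → ℝ)
    (hf : ContDiffOn ℝ (⊤ : ℕ∞) f (Set.Ioi 0))
    (hF : ∀ (n k : ℕ), ∀ x > (0 : ℝ), 0 ≤ Fgen lam f n k x) :
    IsGenStieltjes lam f := by
  obtain ⟨c, hc0, happ⟩ := exists_approx_measure hlam hf hF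
  choose ρ hρ0 hρ using fun N : ℕ => happ (N + 1) N.succ_ne_zero
  choose σ hσ using fun N => exists_measure_unitInterval lam (hρ0 N)
  set g : ℝ≥0∞ := ENNReal.ofReal (Real.Gamma lam) with hg
  have hg0 : g ≠ 0 := (ENNReal.ofReal_pos.2 (Real.Gamma_pos_of_pos hlam)).ne'
  have hgt : g ≠ ⊤ := ENNReal.ofReal_ne_top
  have hct : ENNReal.ofReal c ≠ ⊤ := ENNReal.ofReal_ne_top
  have hr : Tendsto (fun N : ℕ => truncGamma lam (N + 1) / g) atTop (𝓝 1) := by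
    have h := ENNReal.Tendsto.div_const ((tendsto_truncGamma hlam).comp (tendsto_add_atTop_nat 1))
      (Or.inr hg0)
    rwa [← hg, ENNReal.div_self hg0 hgt] at h
  have hlim : ∀ (x : ℝ) (hx : 0 < x),
      Tendsto (fun N => ∫⁻ θ, unitKernel lam hx θ ∂σ N) atTop
        (𝓝 (ENNReal.ofReal (f x) - ENNReal.ofReal c)) := by
    intro x hx
    have hup : Tendsto (fun N : ℕ => (ENNReal.ofReal (f x) - ENNReal.ofReal c) /
        (truncGamma lam (N + 1) / g)) atTop (𝓝 (ENNReal.ofReal (f x) - ENNReal.ofReal c)) := by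
      have h := ENNReal.Tendsto.const_div (a := ENNReal.ofReal (f x) - ENNReal.ofReal c) hr
        (Or.inl ENNReal.one_ne_top)
      rwa [div_one] at h
    refine tendsto_of_tendsto_of_tendsto_of_le_of_le' tendsto_const_nhds hup
      (Eventually.of_forall fun N => ?_) ?_
    · rw [hσ]
      exact tsub_le_iff_left.2 (hρ N x hx).1
    · filter_upwards [hr.eventually_ne one_ne_zero, hr.eventually_ne ENNReal.one_ne_top]
        with N h0 htop
      rw [hσ, ENNReal.le_div_iff_mul_le (Or.inl h0) (Or.inl htop), mul_comm]
      exact ENNReal.le_sub_of_add_le_left hct (hρ N x hx).2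
  have hmass : Tendsto (fun N => σ N univ) atTop
      (𝓝 (ENNReal.ofReal (f 1) - ENNReal.ofReal c)) := by
    refine (hlim 1 one_pos).congr fun N => ?_
    simp [coe_unitKernel]
  obtain ⟨μ, hμ, hμlim⟩ := exists_isFiniteMeasure_of_tendsto_lintegral σ
    (ENNReal.sub_ne_top ENNReal.ofReal_ne_top) hmass
  obtain ⟨ν, hν0, hν⟩ := exists_measure_of_unitInterval lam μ
  have hrep : ∀ x > 0, ENNReal.ofReal (f x) =
      ENNReal.ofReal c + (μ {0} + ∫⁻ t, ENNReal.ofReal ((x + t) ^ (-lam)) ∂ν) := by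
    intro x hx
    have hle : ENNReal.ofReal c ≤ ENNReal.ofReal (f x) :=
      le_self_add.trans (hρ 0 x hx).2
    rw [← hν x hx, hμlim _ _ (hlim x hx), add_tsub_cancel_of_le hle]
  have hνae : ∀ᵐ t ∂ν, 0 ≤ t := by
    rw [ae_iff]
    simpa [Iio, not_le] using hν0
  have hfin : ∀ x > 0, ∫⁻ t, ENNReal.ofReal ((x + t) ^ (-lam)) ∂ν ≠ ⊤ := fun x hx h => by
    have := hrep x hx
    rw [h, add_top, add_top] at this
    exact ENNReal.ofReal_ne_top this
  have hnn : ∀ x > 0, 0 ≤ᵐ[ν] fun t => (x + t) ^ (-lam) := fun x hx => by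
    filter_upwards [hνae] with t ht
    exact Real.rpow_nonneg (by positivity) _
  have hmeas : ∀ x : ℝ, AEStronglyMeasurable (fun t => (x + t) ^ (-lam)) ν := fun x =>
    (by fun_prop : Measurable fun t : ℝ => (x + t) ^ (-lam)).aestronglyMeasurable
  refine ⟨c + μ.real {0}, ν, by positivity, hν0, fun x hx => ?_, fun x hx => ?_⟩
  · exact (lintegral_ofReal_ne_top_iff_integrable (hmeas x) (hnn x hx)).1 (hfin x hx)
  · have hfx : 0 ≤ f x := by
      have := hF 0 0 x hx
      rw [Fgen_zero_right hlam] at this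
      simpa using this
    rw [integral_eq_lintegral_of_nonneg_ae (hnn x hx) (hmeas x), ← ENNReal.toReal_ofReal hfx,
      hrep x hx, ENNReal.toReal_add hct (ENNReal.add_ne_top.2 ⟨measure_ne_top _ _, hfin x hx⟩),
      ENNReal.toReal_add (measure_ne_top _ _) (hfin x hx), ENNReal.toReal_ofReal hc0, ← add_assoc]
    rfl
end

section
/- Let f : (0,∞) → ℝ. Then f is a Stieltjes function (i.e. a generalized Stieltjes function of order 1) if and only if f is C^∞ and the quantities F_{n,k}(x) = (−1)^n Σ_{j=0}^{k} binom(k,j) ((n+k)!/(n+j)!) x^j f^{(n+j)}(x) are nonnegative for all integers n, k ≥ 0 and all x > 0. -/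
open MeasureTheory Set Filter

/-- `f` is a Stieltjes function, i.e. a generalized Stieltjes function of order `1`. -/
def IsStieltjes (f : ℝ → ℝ) : Prop :=
  ∃ (C : ℝ) (ρ : Measure ℝ), 0 ≤ C ∧ ρ (Set.Iio 0) = 0 ∧
    (∀ x > (0 : ℝ), Integrable (fun t => (x + t) ^ (-(1 : ℝ))) ρ) ∧
    ∀ x > (0 : ℝ), f x = C + ∫ t, (x + t) ^ (-(1 : ℝ)) ∂ρ

/-- `F_{n,k}(x) = (−1)^n Σ_{j=0}^{k} C(k,j) ((n+k)!/(n+j)!) x^j f^{(n+j)}(x)`. -/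
noncomputable def Fst (f : ℝ → ℝ) (n k : ℕ) (x : ℝ) : ℝ :=
  (-1 : ℝ) ^ n * ∑ j ∈ Finset.range (k + 1),
    (k.choose j : ℝ) * (((n + k).factorial : ℝ) / ((n + j).factorial : ℝ)) *
      x ^ j * iteratedDerivWithin (n + j) f (Set.Ioi 0) x

/-- `D n` is the `n`-th derivative of `D 0` at each point of `(0,∞)`. -/
def IsDerivTower (D : ℕ → ℝ → ℝ) : Prop :=
  ∀ n x, 0 < x → HasDerivAt (D n) (D (n + 1) x) x

namespace IsDerivTower

variable {D E : ℕ → ℝ → ℝ}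

theorem sub (hD : IsDerivTower D) (hE : IsDerivTower E) :
    IsDerivTower fun n x => D n x - E n x :=
  fun n x hx => (hD n x hx).sub (hE n x hx)

theorem iteratedDerivWithin_eq (hD : IsDerivTower D) {s : Set ℝ} (hs : UniqueDiffOn ℝ s)
    (hpos : s ⊆ Ioi 0) (n : ℕ) : EqOn (iteratedDerivWithin n (D 0) s) (D n) s := by
  induction n with
  | zero => intro x _; simp
  | succ n ih =>
    intro x hx
    rw [iteratedDerivWithin_succ, derivWithin_congr ih (ih hx)]
    exact (hD n x (hpos hx)).hasDerivWithinAt.derivWithin (hs x hx)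

theorem contDiffOn (hD : IsDerivTower D) {s : Set ℝ} (hs : UniqueDiffOn ℝ s)
    (hpos : s ⊆ Ioi 0) : ContDiffOn ℝ (⊤ : ℕ∞) (D 0) s := by
  refine contDiffOn_of_differentiableOn_deriv fun m _ => ?_
  refine DifferentiableOn.congr (fun x hx => ?_) (hD.iteratedDerivWithin_eq hs hpos m)
  exact (hD m x (hpos hx)).differentiableAt.differentiableWithinAt

theorem _root_.ContDiffOn.isDerivTower {f : ℝ → ℝ} (hf : ContDiffOn ℝ (⊤ : ℕ∞) f (Ioi 0)) :
    IsDerivTower fun n => iteratedDerivWithin n f (Ioi 0) := by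
  intro n x hx
  have hd := hf.differentiableOn_iteratedDerivWithin (m := n)
    (by exact_mod_cast ENat.natCast_lt_top n) (uniqueDiffOn_Ioi 0)
  simp only [iteratedDerivWithin_succ]
  exact (hd x hx).hasDerivWithinAt.hasDerivAt (Ioi_mem_nhds hx)

/-- Taylor's formula with Lagrange remainder. -/
theorem exists_taylor (hD : IsDerivTower D) {a x : ℝ} (ha : 0 < a) (hx : 0 < x) (hax : a ≠ x)
    (n : ℕ) : ∃ y ∈ uIoo a x, D 0 x =
      ∑ j ∈ Finset.range (n + 1), D j a * (x - a) ^ j / (j.factorial : ℝ) +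
        D (n + 1) y * (x - a) ^ (n + 1) / ((n + 1).factorial : ℝ) := by
  have hu : UniqueDiffOn ℝ (uIcc a x) := uniqueDiffOn_uIcc hax
  have hsub : uIcc a x ⊆ Ioi 0 := fun y hy => lt_of_lt_of_le (lt_min ha hx) hy.1
  have hc := hD.contDiffOn hu hsub
  obtain ⟨y, hy, h⟩ := taylor_mean_remainder_lagrange (n := n) hax
    (hc.of_le (by exact_mod_cast le_top))
    ((hc.differentiableOn_iteratedDerivWithin
      (by exact_mod_cast ENat.natCast_lt_top n) hu).mono uIoo_subset_uIcc_self)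
  refine ⟨y, hy, ?_⟩
  rw [hD.iteratedDerivWithin_eq hu hsub _ (uIoo_subset_uIcc_self hy), taylor_within_apply] at h
  rw [← h, Finset.sum_congr rfl (fun j _ => ?_), add_sub_cancel]
  rw [hD.iteratedDerivWithin_eq hu hsub _ left_mem_uIcc, smul_eq_mul]
  ring

/-- A derivative bound for completely monotone functions. -/
theorem abs_le (hD : IsDerivTower D) (hpos : ∀ n x, 0 < x → 0 ≤ (-1 : ℝ) ^ n * D n x)
    {z y : ℝ} (hz : 0 < z) (hzy : z < y) (n : ℕ) :
    |D n y| * (y - z) ^ n ≤ n.factorial * D 0 z := by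
  obtain ⟨w, hw, h⟩ := hD.exists_taylor (hz.trans hzy) hz hzy.ne' n
  have hw0 : 0 < w := lt_of_le_of_lt (le_min (hz.trans hzy).le hz.le) hw.1
  have key (m : ℕ) (u : ℝ) : D m u * (z - y) ^ m = (-1) ^ m * D m u * (y - z) ^ m := by
    rw [← neg_sub y z, neg_pow]; ring
  have hyz : 0 ≤ y - z := by linarith
  have hnn (m : ℕ) (u : ℝ) (hu : 0 < u) : 0 ≤ D m u * (z - y) ^ m / (m.factorial : ℝ) := by
    rw [key]
    have := hpos m u hu
    positivity
  have hterm := Finset.single_le_sum (f := fun j => D j y * (z - y) ^ j / (j.factorial : ℝ))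
    (fun j _ => hnn j y (hz.trans hzy)) (Finset.self_mem_range_succ n)
  have hrem := hnn (n + 1) w hw0
  have hle : D n y * (z - y) ^ n / (n.factorial : ℝ) ≤ D 0 z := by linarith
  have habs : |D n y| = (-1) ^ n * D n y := by
    rw [← abs_of_nonneg (hpos n y (hz.trans hzy))]
    simp [abs_mul]
  rw [div_le_iff₀ (by positivity), key, ← habs] at hle
  linarith

/-- Two completely monotone functions with the same derivatives at `a` have the same derivatives
at every point close to `a`. -/
theorem eq_of_near (hD : IsDerivTower D) (hE : IsDerivTower E)
    (hDpos : ∀ n x, 0 < x → 0 ≤ (-1 : ℝ) ^ n * D n x)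
    (hEpos : ∀ n x, 0 < x → 0 ≤ (-1 : ℝ) ^ n * E n x) {a : ℝ} (ha : 0 < a)
    (h : ∀ n, D n a = E n a) {x : ℝ} (hx : |x - a| ≤ a / 4) : D 0 x = E 0 x := by
  rcases eq_or_ne a x with rfl | hax
  · exact h 0
  obtain ⟨hx1, hx2⟩ := abs_le'.1 hx
  have hx0 : 0 < x := by linarith
  have hbound (n : ℕ) : |D 0 x - E 0 x| ≤ (D 0 (a / 4) + E 0 (a / 4)) * (1 / 2) ^ (n + 1) := by
    obtain ⟨y, hy, hT⟩ := (hD.sub hE).exists_taylor ha hx0 hax n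
    have hy' : 3 * a / 4 ≤ y := le_trans (le_min (by linarith) (by linarith)) hy.1.le
    have hzy : a / 4 < y := by linarith
    simp only [h, sub_self, zero_mul, zero_div, Finset.sum_const_zero, zero_add] at hT
    rw [hT, abs_div, abs_mul, abs_pow, Nat.abs_cast, div_le_iff₀ (by positivity)]
    have h1 := hD.abs_le hDpos (by linarith) hzy (n + 1)
    have h2 := hE.abs_le hEpos (by linarith) hzy (n + 1)
    have h3 : |x - a| ^ (n + 1) ≤ (y - a / 4) ^ (n + 1) * (1 / 2) ^ (n + 1) := by
      rw [← mul_pow]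
      exact pow_le_pow_left₀ (abs_nonneg _) (by linarith) _
    calc |D (n + 1) y - E (n + 1) y| * |x - a| ^ (n + 1)
        ≤ (|D (n + 1) y| + |E (n + 1) y|) * ((y - a / 4) ^ (n + 1) * (1 / 2) ^ (n + 1)) := by
          gcongr
          exact abs_sub _ _
      _ = (|D (n + 1) y| * (y - a / 4) ^ (n + 1) + |E (n + 1) y| * (y - a / 4) ^ (n + 1)) *
            (1 / 2) ^ (n + 1) := by ring
      _ ≤ ((n + 1).factorial * D 0 (a / 4) + (n + 1).factorial * E 0 (a / 4)) *
            (1 / 2) ^ (n + 1) := by gcongr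
      _ = _ := by ring
  have hlim : Tendsto (fun n : ℕ => (D 0 (a / 4) + E 0 (a / 4)) * (1 / 2 : ℝ) ^ (n + 1))
      atTop (nhds 0) := by
    simpa using ((tendsto_pow_atTop_nhds_zero_of_lt_one (r := (1 / 2 : ℝ)) (by norm_num)
      (by norm_num)).comp (tendsto_add_atTop_nat 1)).const_mul (D 0 (a / 4) + E 0 (a / 4))
  have := ge_of_tendsto' hlim hbound
  exact sub_eq_zero.1 (abs_nonpos_iff.1 this)

theorem shift (hD : IsDerivTower D) (m : ℕ) : IsDerivTower fun n x => (-1) ^ m * D (n + m) x :=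
  fun n x hx => by
    simpa [add_right_comm] using (hD (n + m) x hx).const_mul ((-1 : ℝ) ^ m)

/-- A completely monotone function is determined by its derivatives at `1`. -/
theorem eqOn_of_eq_at_one (hD : IsDerivTower D) (hE : IsDerivTower E)
    (hDpos : ∀ n x, 0 < x → 0 ≤ (-1 : ℝ) ^ n * D n x)
    (hEpos : ∀ n x, 0 < x → 0 ≤ (-1 : ℝ) ^ n * E n x)
    (h : ∀ n, D n 1 = E n 1) : EqOn (D 0) (E 0) (Ioi 0) := by
  have hstep {a x : ℝ} (ha : 0 < a) (heq : ∀ n, D n a = E n a) (hx : |x - a| ≤ a / 4) (m : ℕ) :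
      D m x = E m x := by
    have hs (F : ℕ → ℝ → ℝ) (hF : ∀ n x, 0 < x → 0 ≤ (-1 : ℝ) ^ n * F n x) (n : ℕ) (x : ℝ)
        (hx : 0 < x) : 0 ≤ (-1 : ℝ) ^ n * ((-1) ^ m * F (n + m) x) := by
      simpa [pow_add, mul_assoc] using hF (n + m) x hx
    have := (hD.shift m).eq_of_near (hE.shift m) (hs D hDpos) (hs E hEpos) ha
      (fun n => by simp only [heq]) hx
    simpa using this
  have hpow (k : ℕ) : ∀ x : ℝ, (4 / 5 : ℝ) ^ k ≤ x → x ≤ (5 / 4 : ℝ) ^ k → ∀ n, D n x = E n x := by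
    induction k with
    | zero =>
      intro x h1 h2
      have : x = 1 := le_antisymm (by simpa using h2) (by simpa using h1)
      rwa [this]
    | succ k ih =>
      intro x h1 h2 n
      have hx0 : 0 < x := lt_of_lt_of_le (by positivity) h1
      rw [pow_succ] at h1 h2
      have hp : (4 / 5 : ℝ) ^ k ≤ 1 := pow_le_one₀ (by norm_num) (by norm_num)
      have hq : 1 ≤ (5 / 4 : ℝ) ^ k := one_le_pow₀ (by norm_num)
      rcases le_total x 1 with hx1 | hx1
      · refine hstep (a := min 1 (x * (5 / 4))) (by positivity)
          (ih _ (le_min hp (by linarith)) ((min_le_left _ _).trans hq)) ?_ n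
        rw [_root_.abs_le]
        rcases min_cases (1 : ℝ) (x * (5 / 4)) with hm | hm <;> constructor <;> linarith
      · refine hstep (a := max 1 (x * (4 / 5))) (by positivity)
          (ih _ (hp.trans (le_max_left _ _)) (max_le hq (by linarith))) ?_ n
        rw [_root_.abs_le]
        rcases max_cases (1 : ℝ) (x * (4 / 5)) with hm | hm <;> constructor <;> linarith
  intro x hx
  obtain ⟨k, hk⟩ := pow_unbounded_of_one_lt (max x x⁻¹) (show (1 : ℝ) < 5 / 4 by norm_num)
  refine hpow k x ?_ ((le_max_left _ _).trans hk.le) 0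
  have := inv_anti₀ (inv_pos.2 hx) ((le_max_right x x⁻¹).trans hk.le)
  rwa [inv_inv, ← inv_pow, show (5 / 4 : ℝ)⁻¹ = 4 / 5 by norm_num] at this

end IsDerivTower

/-- The total mass identity for the discrete measures in the Hausdorff moment problem. -/
theorem sum_choose_mul_eq_of_pascal {a : ℕ → ℕ → ℝ}
    (ha : ∀ n k, a n k = a (n + 1) k + a n (k + 1)) (N : ℕ) :
    ∑ i ∈ Finset.range (N + 1), (N.choose i : ℝ) * a i (N - i) = a 0 0 := by
  induction N with
  | zero => simp
  | succ N ih =>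
    rw [Finset.sum_choose_succ_mul, ← ih, ← Finset.sum_add_distrib]
    refine Finset.sum_congr rfl fun i hi => ?_
    rw [ha i (N - i), show N + 1 - i = N - i + 1 by grind]
    ring

theorem abs_pow_sub_pow_le_of_mem_Icc {x y : ℝ} (hx : x ∈ Icc (0 : ℝ) 1) (hy : y ∈ Icc (0 : ℝ) 1)
    (m : ℕ) : |x ^ m - y ^ m| ≤ m * |x - y| := by
  induction m with
  | zero => simp
  | succ m ih =>
    have hxm : |x ^ m| ≤ 1 := by
      rw [abs_of_nonneg (pow_nonneg hx.1 m)]; exact pow_le_one₀ hx.1 hx.2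
    have hy1 : |y| ≤ 1 := by rw [abs_of_nonneg hy.1]; exact hy.2
    calc |x ^ (m + 1) - y ^ (m + 1)| = |x ^ m * (x - y) + y * (x ^ m - y ^ m)| := by ring_nf
      _ ≤ |x ^ m| * |x - y| + |y| * |x ^ m - y ^ m| := by
        simpa only [abs_mul] using abs_add_le (x ^ m * (x - y)) (y * (x ^ m - y ^ m))
      _ ≤ 1 * |x - y| + 1 * (m * |x - y|) := by gcongr
      _ = _ := by push_cast; ring

/-- Convergence of the moments of the discrete measures in the Hausdorff moment problem. -/
theorem tendsto_sum_choose_mul_pow {a : ℕ → ℕ → ℝ} (ha0 : ∀ n k, 0 ≤ a n k)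
    (ha : ∀ n k, a n k = a (n + 1) k + a n (k + 1)) (m : ℕ) :
    Tendsto (fun N : ℕ => ∑ i ∈ Finset.range (N + 1),
      (N.choose i : ℝ) * a i (N - i) * ((i : ℝ) / N) ^ m) atTop (nhds (a m 0)) := by
  induction m generalizing a with
  | zero => simp [sum_choose_mul_eq_of_pascal ha]
  | succ m ih =>
    have hlim := ih (a := fun n k => a (n + 1) k) (fun n k => ha0 _ _) (fun n k => ha _ _)
    rw [← tendsto_add_atTop_iff_nat 1]
    refine hlim.congr_dist ?_
    have hz : Tendsto (fun N : ℕ => a 1 0 * (m * (1 / ((N : ℝ) + 1)))) atTop (nhds 0) := by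
      simpa using (tendsto_one_div_add_atTop_nhds_zero_nat (𝕜 := ℝ)).const_mul (m : ℝ)
        |>.const_mul (a 1 0)
    refine squeeze_zero' (Eventually.of_forall fun _ => dist_nonneg) ?_ hz
    filter_upwards [eventually_gt_atTop 0] with N hN
    have hN' : (0 : ℝ) < N := by exact_mod_cast hN
    have hsum : ∑ i ∈ Finset.range (N + 1 + 1), ((N + 1).choose i : ℝ) * a i (N + 1 - i) *
          ((i : ℝ) / ((N + 1 : ℕ) : ℝ)) ^ (m + 1) =
        ∑ i ∈ Finset.range (N + 1), (N.choose i : ℝ) * a (i + 1) (N - i) *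
          (((i : ℝ) + 1) / ((N : ℝ) + 1)) ^ m := by
      rw [Finset.sum_range_succ']
      simp only [Nat.cast_zero, zero_div, ne_eq, Nat.add_eq_zero_iff, one_ne_zero, and_false,
        not_false_eq_true, zero_pow, mul_zero, add_zero]
      refine Finset.sum_congr rfl fun i _ => ?_
      have hc : ((N : ℝ) + 1) * N.choose i = (N + 1).choose (i + 1) * ((i : ℝ) + 1) := by
        exact_mod_cast Nat.add_one_mul_choose_eq N i
      have hc' : (N.choose i : ℝ) = (N + 1).choose (i + 1) * (((i : ℝ) + 1) / ((N : ℝ) + 1)) := by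
        field_simp
        linarith
      rw [hc', Nat.add_sub_add_right, pow_succ]
      push_cast
      ring
    rw [hsum, Real.dist_eq, ← Finset.sum_sub_distrib,
      ← sum_choose_mul_eq_of_pascal (a := fun n k => a (n + 1) k) (fun n k => ha _ _) N,
      Finset.sum_mul]
    refine (Finset.abs_sum_le_sum_abs _ _).trans (Finset.sum_le_sum fun i hi => ?_)
    have hiN : (i : ℝ) ≤ N := by exact_mod_cast Nat.lt_succ_iff.1 (Finset.mem_range.1 hi)
    have hi0 : (0 : ℝ) ≤ i := by positivity
    rw [← mul_sub, abs_mul, abs_of_nonneg (mul_nonneg (Nat.cast_nonneg _) (ha0 _ _))]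
    refine mul_le_mul_of_nonneg_left ?_ (mul_nonneg (Nat.cast_nonneg _) (ha0 _ _))
    refine (abs_pow_sub_pow_le_of_mem_Icc ⟨by positivity, (div_le_one hN').2 hiN⟩
      ⟨by positivity, (div_le_one (by positivity)).2 (by linarith)⟩ m).trans ?_
    refine mul_le_mul_of_nonneg_left ?_ (Nat.cast_nonneg _)
    have : (i : ℝ) / N - (i + 1) / (N + 1) = -((1 - i / N) * (1 / (N + 1))) := by
      field_simp
      ring
    have h1 : (i : ℝ) / N ≤ 1 := (div_le_one hN').2 hiN
    have h2 : 0 ≤ (i : ℝ) / N := by positivity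
    rw [this, abs_neg, abs_mul, abs_of_nonneg (sub_nonneg.2 h1),
      abs_of_nonneg (show (0 : ℝ) ≤ 1 / (N + 1) by positivity)]
    exact mul_le_of_le_one_left (by positivity) (by linarith)

open scoped CompactlySupported in
/-- A pointwise bounded sequence of positive linear functionals on `C(X)`, `X` compact, has
a cluster point which is represented by a measure. -/
theorem exists_measure_of_tendsto {X : Type*} [TopologicalSpace X] [T2Space X] [CompactSpace X]
    [MeasurableSpace X] [BorelSpace X] (L : ℕ → C_c(X, ℝ) →ₗ[ℝ] ℝ)
    (hL : ∀ N φ, 0 ≤ φ → 0 ≤ L N φ) (hbdd : ∀ φ, ∃ M, ∀ N, |L N φ| ≤ M) :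
    ∃ μ : Measure X, IsFiniteMeasure μ ∧ ∀ (φ : C_c(X, ℝ)) (l : ℝ),
      Tendsto (fun N => L N φ) atTop (nhds l) → ∫ x, φ x ∂μ = l := by
  let U : Ultrafilter ℕ := hyperfilter ℕ
  have hex (φ : C_c(X, ℝ)) : ∃ l, Tendsto (fun N => L N φ) U (nhds l) := by
    obtain ⟨M, hM⟩ := hbdd φ
    obtain ⟨l, -, hl⟩ := (isCompact_Icc (a := -M) (b := M)).ultrafilter_le_nhds
      (U.map fun N => L N φ) (tendsto_principal.2 <|
        Eventually.of_forall fun N => abs_le.1 (hM N))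
    exact ⟨l, hl⟩
  choose l hl using hex
  let Λ₀ : C_c(X, ℝ) →ₗ[ℝ] ℝ :=
    { toFun := l
      map_add' := fun φ ψ => tendsto_nhds_unique (hl _) (by
        simpa only [map_add] using (hl φ).add (hl ψ))
      map_smul' := fun c φ => tendsto_nhds_unique (hl _) (by
        simpa only [map_smul, RingHom.id_apply] using (hl φ).const_smul c) }
  let Λ : C_c(X, ℝ) →ₚ[ℝ] ℝ := PositiveLinearMap.mk₀ Λ₀ fun φ hφ =>
    ge_of_tendsto' (hl φ) fun N => hL N φ hφ
  refine ⟨RealRMK.rieszMeasure Λ, inferInstance, fun φ c hc => ?_⟩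
  rw [RealRMK.integral_rieszMeasure]
  exact tendsto_nhds_unique (hl φ) (hc.mono_left Nat.hyperfilter_le_atTop)

open scoped unitInterval CompactlySupported in
/-- The Hausdorff moment theorem. -/
theorem exists_measure_moment_eq {b : ℕ → ℝ}
    (hb : ∀ n k : ℕ, 0 ≤ ∑ j ∈ Finset.range (k + 1), (k.choose j : ℝ) * ((-1) ^ j * b (n + j))) :
    ∃ μ : Measure I, IsFiniteMeasure μ ∧ ∀ n : ℕ, ∫ v : I, (v : ℝ) ^ n ∂μ = b n := by
  set a : ℕ → ℕ → ℝ := fun n k =>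
    ∑ j ∈ Finset.range (k + 1), (k.choose j : ℝ) * ((-1) ^ j * b (n + j)) with ha_def
  have ha (n k : ℕ) : a n k = a (n + 1) k + a n (k + 1) := by
    simp only [ha_def]
    rw [Finset.sum_choose_succ_mul (fun j _ => (-1) ^ j * b (n + j)), add_left_comm,
      ← Finset.sum_add_distrib, eq_comm, add_eq_left]
    refine Finset.sum_eq_zero fun j _ => ?_
    rw [show n + 1 + j = n + (j + 1) by ring]
    ring
  have hmem (N i : ℕ) (hi : i ∈ Finset.range (N + 1)) : (i : ℝ) / N ∈ I := by
    refine ⟨by positivity, div_le_one_of_le₀ ?_ (by positivity)⟩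
    exact_mod_cast Nat.lt_succ_iff.1 (Finset.mem_range.1 hi)
  let L (N : ℕ) : C_c(I, ℝ) →ₗ[ℝ] ℝ :=
    { toFun := fun φ => ∑ i ∈ Finset.range (N + 1),
        (N.choose i : ℝ) * a i (N - i) * φ (projIcc 0 1 zero_le_one ((i : ℝ) / N))
      map_add' := fun φ ψ => by
        simp only [CompactlySupportedContinuousMap.add_apply, mul_add, Finset.sum_add_distrib]
      map_smul' := fun c φ => by
        simp only [CompactlySupportedContinuousMap.smul_apply, smul_eq_mul, Finset.mul_sum,
          RingHom.id_apply]
        exact Finset.sum_congr rfl fun i _ => by ring }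
  have hw (N i : ℕ) : 0 ≤ (N.choose i : ℝ) * a i (N - i) :=
    mul_nonneg (Nat.cast_nonneg _) (hb _ _)
  obtain ⟨μ, hμ, h⟩ := exists_measure_of_tendsto L
    (fun N φ hφ => by
      change 0 ≤ ∑ i ∈ Finset.range (N + 1), (N.choose i : ℝ) * a i (N - i) * φ _
      exact Finset.sum_nonneg fun i _ => mul_nonneg (hw N i) (hφ _)) (fun φ => by
      obtain ⟨M, hM⟩ := (isCompact_univ (X := I)).exists_bound_of_continuousOn
        φ.continuous.continuousOn
      refine ⟨a 0 0 * M, fun N => ?_⟩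
      rw [← sum_choose_mul_eq_of_pascal ha N, Finset.sum_mul]
      change |∑ i ∈ Finset.range (N + 1), (N.choose i : ℝ) * a i (N - i) * φ _| ≤ _
      refine (Finset.abs_sum_le_sum_abs _ _).trans (Finset.sum_le_sum fun i _ => ?_)
      rw [abs_mul, abs_of_nonneg (hw N i)]
      exact mul_le_mul_of_nonneg_left (hM _ (mem_univ _)) (hw N i))
  refine ⟨μ, hμ, fun n => ?_⟩
  have hb' : a n 0 = b n := by simp [ha_def]
  rw [← hb']
  refine h (CompactlySupportedContinuousMap.continuousMapEquiv
    ⟨fun v : I => (v : ℝ) ^ n, by fun_prop⟩) _ ?_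
  refine (tendsto_sum_choose_mul_pow hb ha n).congr fun N => ?_
  refine Finset.sum_congr rfl fun i hi => ?_
  rw [projIcc_of_mem _ (hmem N i hi)]
  rfl

section StieltjesKernel

variable {ρ : Measure ℝ}

theorem ae_nonneg_of_measure_Iio_eq_zero (hρ : ρ (Iio 0) = 0) : ∀ᵐ t ∂ρ, 0 ≤ t := by
  simp only [ae_iff, not_le]
  exact hρ

theorem integrable_inv_add_pow (hρ : ρ (Iio 0) = 0)
    (hint : ∀ x > (0 : ℝ), Integrable (fun t => (x + t)⁻¹) ρ) {x : ℝ} (hx : 0 < x) (n : ℕ) :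
    Integrable (fun t => ((x + t)⁻¹) ^ (n + 1)) ρ := by
  refine ((hint x hx).const_mul ((x⁻¹) ^ n)).mono' (by fun_prop) ?_
  filter_upwards [ae_nonneg_of_measure_Iio_eq_zero hρ] with t ht
  have hxt : 0 < x + t := by linarith
  rw [Real.norm_of_nonneg (by positivity), pow_succ]
  gcongr
  linarith

theorem hasDerivAt_integral_inv_add_pow (hρ : ρ (Iio 0) = 0)
    (hint : ∀ x > (0 : ℝ), Integrable (fun t => (x + t)⁻¹) ρ) {x : ℝ} (hx : 0 < x) (n : ℕ) :
    HasDerivAt (fun y => ∫ t, ((y + t)⁻¹) ^ (n + 1) ∂ρ)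
      (-(n + 1) * ∫ t, ((x + t)⁻¹) ^ (n + 2) ∂ρ) x := by
  rw [← integral_const_mul]
  refine (hasDerivAt_integral_of_dominated_loc_of_deriv_le (s := Ioi (x / 2))
    (bound := fun t => ((n : ℝ) + 1) * ((x / 2 + t)⁻¹) ^ (n + 2))
    (F' := fun y t => -((n : ℝ) + 1) * ((y + t)⁻¹) ^ (n + 2)) (Ioi_mem_nhds (by linarith))
    (Eventually.of_forall fun y => by fun_prop) (integrable_inv_add_pow hρ hint hx n)
    (by fun_prop) ?_ ((integrable_inv_add_pow hρ hint (half_pos hx) (n + 1)).const_mul _) ?_).2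
  · filter_upwards [ae_nonneg_of_measure_Iio_eq_zero hρ] with t ht y hy
    have hy' : x / 2 < y := hy
    have hyt : 0 < y + t := by linarith
    rw [norm_mul, norm_neg, Real.norm_of_nonneg (by positivity),
      Real.norm_of_nonneg (by positivity)]
    gcongr
  · filter_upwards [ae_nonneg_of_measure_Iio_eq_zero hρ] with t ht y hy
    have hy' : x / 2 < y := hy
    have hyt : y + t ≠ 0 := by linarith
    refine ((((hasDerivAt_id y).add_const t).inv hyt).pow (n + 1)).congr_deriv ?_
    simp only [id_eq, Nat.add_sub_cancel, Pi.inv_apply, Nat.cast_add, Nat.cast_one]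
    rw [div_eq_mul_inv, ← inv_pow]
    ring

/-- The successive derivatives of the Stieltjes function with constant `C` and measure `ρ`. -/
noncomputable def stieltjesDeriv (C : ℝ) (ρ : Measure ℝ) (n : ℕ) (x : ℝ) : ℝ :=
  (-1) ^ n * n.factorial * ((if n = 0 then C else 0) + ∫ t, ((x + t)⁻¹) ^ (n + 1) ∂ρ)

theorem stieltjesDeriv_zero (C : ℝ) (ρ : Measure ℝ) (x : ℝ) :
    stieltjesDeriv C ρ 0 x = C + ∫ t, (x + t) ^ (-(1 : ℝ)) ∂ρ := by
  simp [stieltjesDeriv, Real.rpow_neg_one]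

theorem isDerivTower_stieltjesDeriv (C : ℝ) (hρ : ρ (Iio 0) = 0)
    (hint : ∀ x > (0 : ℝ), Integrable (fun t => (x + t)⁻¹) ρ) :
    IsDerivTower (stieltjesDeriv C ρ) := by
  intro n x hx
  refine (((hasDerivAt_integral_inv_add_pow hρ hint hx n).const_add
    (if n = 0 then C else 0)).const_mul ((-1 : ℝ) ^ n * n.factorial)).congr_deriv ?_
  simp only [stieltjesDeriv, n.succ_ne_zero, if_false, Nat.factorial_succ]
  push_cast
  ring

theorem sum_stieltjesDeriv_nonneg {C : ℝ} (hC : 0 ≤ C) (hρ : ρ (Iio 0) = 0)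
    (hint : ∀ x > (0 : ℝ), Integrable (fun t => (x + t)⁻¹) ρ) (n k : ℕ) {x : ℝ} (hx : 0 < x) :
    0 ≤ (-1 : ℝ) ^ n * ∑ j ∈ Finset.range (k + 1),
      (k.choose j : ℝ) * (((n + k).factorial : ℝ) / ((n + j).factorial : ℝ)) *
        x ^ j * stieltjesDeriv C ρ (n + j) x := by
  have hterm (j : ℕ) : (-1 : ℝ) ^ n * ((k.choose j : ℝ) * (((n + k).factorial : ℝ) /
        ((n + j).factorial : ℝ)) * x ^ j * stieltjesDeriv C ρ (n + j) x) =
      (n + k).factorial * ((k.choose j : ℝ) * (-x) ^ j * (if n + j = 0 then C else 0) +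
        ∫ t, ((x + t)⁻¹) ^ (n + 1) * ((-(x * (x + t)⁻¹)) ^ j * 1 ^ (k - j) * k.choose j) ∂ρ) := by
    have hi : ∫ t, ((x + t)⁻¹) ^ (n + 1) * ((-(x * (x + t)⁻¹)) ^ j * 1 ^ (k - j) * k.choose j) ∂ρ =
        (k.choose j : ℝ) * (-x) ^ j * ∫ t, ((x + t)⁻¹) ^ (n + j + 1) ∂ρ := by
      rw [← integral_const_mul]
      congr 1 with t
      rw [← neg_mul]
      ring
    have hs : (-1 : ℝ) ^ n * (-1) ^ n = 1 := by rw [← mul_pow]; simp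
    rw [hi, stieltjesDeriv, pow_add (-1 : ℝ) n j, neg_pow x]
    have hq := div_mul_cancel₀ ((n + k).factorial : ℝ)
      (Nat.cast_ne_zero.2 (n + j).factorial_ne_zero : ((n + j).factorial : ℝ) ≠ 0)
    generalize ∫ t, ((x + t)⁻¹) ^ (n + j + 1) ∂ρ = K
    generalize (if n + j = 0 then C else 0) = c
    linear_combination (k.choose j : ℝ) * x ^ j * (-1) ^ j * (c + K) *
      ((n + k).factorial * hs + (-1) ^ n * (-1) ^ n * hq)
  rw [Finset.mul_sum, Finset.sum_congr rfl fun j _ => hterm j, ← Finset.mul_sum,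
    Finset.sum_add_distrib, ← integral_finsetSum]
  · refine mul_nonneg (Nat.cast_nonneg _) (add_nonneg (Finset.sum_nonneg fun j _ => ?_) ?_)
    · split_ifs with h
      · obtain rfl : j = 0 := by omega
        simpa using hC
      · simp
    · refine integral_nonneg_of_ae ?_
      filter_upwards [ae_nonneg_of_measure_Iio_eq_zero hρ] with t ht
      have hxt : 0 < x + t := by linarith
      rw [← Finset.mul_sum, ← add_pow]
      have : -(x * (x + t)⁻¹) + 1 = t * (x + t)⁻¹ := by field_simp; ring
      rw [this]
      positivity
  · intro j _
    have := (integrable_inv_add_pow hρ hint hx (n + j)).const_mul ((k.choose j : ℝ) * (-x) ^ j)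
    refine this.congr (Eventually.of_forall fun t => ?_)
    simp only
    rw [← neg_mul]
    ring

theorem IsDerivTower.fst_eq {D : ℕ → ℝ → ℝ} (hD : IsDerivTower D) {f : ℝ → ℝ}
    (hf : EqOn f (D 0) (Ioi 0)) (n k : ℕ) {x : ℝ} (hx : 0 < x) :
    Fst f n k x = (-1 : ℝ) ^ n * ∑ j ∈ Finset.range (k + 1),
      (k.choose j : ℝ) * (((n + k).factorial : ℝ) / ((n + j).factorial : ℝ)) *
        x ^ j * D (n + j) x := by
  simp only [Fst, iteratedDerivWithin_congr hf hx,
    hD.iteratedDerivWithin_eq (uniqueDiffOn_Ioi 0) subset_rfl _ hx]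

end StieltjesKernel

open scoped unitInterval in
/-- Transport of a measure on `[0,1]` to `[0,∞)` via `t = (1 - v) / v`. -/
theorem exists_measure_integral_inv_add_pow (μ : Measure I) [IsFiniteMeasure μ] :
    ∃ (C : ℝ) (ρ : Measure ℝ), 0 ≤ C ∧ ρ (Iio 0) = 0 ∧
      (∀ x > (0 : ℝ), Integrable (fun t => (x + t)⁻¹) ρ) ∧
      ∀ n : ℕ, (if n = 0 then C else 0) + ∫ t, ((1 + t)⁻¹) ^ (n + 1) ∂ρ =
        ∫ v : I, (v : ℝ) ^ n ∂μ := by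
  let w : I → NNReal := fun v => ⟨(v : ℝ)⁻¹, inv_nonneg.2 v.2.1⟩
  have hw : Measurable w := by
    refine Measurable.subtype_mk ?_
    fun_prop
  let T : I → ℝ := fun v => (1 - v) / v
  have hT : Measurable T := by fun_prop
  have hT0 (v : I) : 0 ≤ T v := div_nonneg (sub_nonneg.2 v.2.2) v.2.1
  refine ⟨μ.real {0}, (μ.withDensity fun v => (w v : ENNReal)).map T, measureReal_nonneg,
    ?_, ?_, ?_⟩
  · rw [Measure.map_apply hT measurableSet_Iio]
    have : T ⁻¹' Iio 0 = ∅ := by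
      ext v
      simpa using hT0 v
    simp [this]
  · intro x hx
    rw [integrable_map_measure (by fun_prop) hT.aemeasurable,
      integrable_withDensity_iff_integrable_smul hw]
    refine Integrable.of_bound (by fun_prop) (min x 1)⁻¹ (Eventually.of_forall fun v => ?_)
    have hm : 0 < min x 1 := lt_min hx one_pos
    change ‖(v : ℝ)⁻¹ * (x + (1 - v) / v)⁻¹‖ ≤ _
    rcases v.2.1.eq_or_lt with h0 | h0
    · rw [← h0]
      simpa using hm.le
    · have h1 := v.2.2
      have : (v : ℝ)⁻¹ * (x + (1 - v) / v)⁻¹ = (x * v + 1 * (1 - v))⁻¹ := by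
        rw [← mul_inv]
        congr 1
        field_simp
      have hle : min x 1 ≤ x * v + 1 * (1 - v) := by
        calc min x 1 = min x 1 * v + min x 1 * (1 - v) := by ring
          _ ≤ _ := add_le_add (mul_le_mul_of_nonneg_right (min_le_left _ _) h0.le)
            (mul_le_mul_of_nonneg_right (min_le_right _ _) (sub_nonneg.2 h1))
      rw [this, Real.norm_of_nonneg (inv_nonneg.2 (hm.le.trans hle))]
      exact inv_anti₀ hm hle
  · intro n
    rw [integral_map hT.aemeasurable (by fun_prop), integral_withDensity_eq_integral_smul hw]
    have hC : (if n = 0 then μ.real {0} else 0) =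
        ∫ v : I, ({0} : Set I).indicator (fun _ => if n = 0 then (1 : ℝ) else 0) v ∂μ := by
      rw [integral_indicator_const _ (measurableSet_singleton _)]
      simp
    have hpow : Integrable (fun v : I => (v : ℝ) ^ n) μ :=
      Integrable.of_bound (by fun_prop) 1 (Eventually.of_forall fun v => by
        rw [Real.norm_of_nonneg (pow_nonneg v.2.1 n)]
        exact pow_le_one₀ v.2.1 v.2.2)
    have hind : Integrable
        (({0} : Set I).indicator fun _ => if n = 0 then (1 : ℝ) else 0) μ :=
      (integrable_const _).indicator (measurableSet_singleton _)
    have hkey (v : I) : w v • ((1 + T v)⁻¹) ^ (n + 1) =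
        (v : ℝ) ^ n - ({0} : Set I).indicator (fun _ => if n = 0 then (1 : ℝ) else 0) v := by
      change (v : ℝ)⁻¹ * ((1 + (1 - (v : ℝ)) / v)⁻¹) ^ (n + 1) = _
      rcases eq_or_ne v 0 with rfl | h0
      · rcases n with _ | n <;> simp
      · have h0' : (v : ℝ) ≠ 0 := fun h => h0 (Subtype.ext h)
        rw [indicator_of_notMem (by simpa using h0)]
        have : 1 + (1 - (v : ℝ)) / v = (v : ℝ)⁻¹ := by field_simp; ring
        rw [this, inv_inv, pow_succ]
        field_simp
        ring
    simp only [hkey]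
    rw [integral_sub hpow hind, hC]
    ring

theorem IsStieltjes.contDiffOn_and_fst_nonneg {f : ℝ → ℝ} (hf : IsStieltjes f) :
    ContDiffOn ℝ (⊤ : ℕ∞) f (Ioi 0) ∧ ∀ (n k : ℕ), ∀ x > (0 : ℝ), 0 ≤ Fst f n k x := by
  obtain ⟨C, ρ, hC, hρ, hint, hf⟩ := hf
  simp only [Real.rpow_neg_one] at hint
  have hD := isDerivTower_stieltjesDeriv C hρ hint
  have heq : EqOn f (stieltjesDeriv C ρ 0) (Ioi 0) := fun x hx => by
    rw [hf x hx, stieltjesDeriv_zero]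
  refine ⟨(hD.contDiffOn (uniqueDiffOn_Ioi 0) subset_rfl).congr heq, fun n k x hx => ?_⟩
  rw [hD.fst_eq heq n k hx]
  exact sum_stieltjesDeriv_nonneg hC hρ hint n k hx

theorem isStieltjes_of_fst_nonneg {f : ℝ → ℝ} (hf : ContDiffOn ℝ (⊤ : ℕ∞) f (Ioi 0))
    (hpos : ∀ (n k : ℕ), ∀ x > (0 : ℝ), 0 ≤ Fst f n k x) : IsStieltjes f := by
  set D : ℕ → ℝ → ℝ := fun n => iteratedDerivWithin n f (Ioi 0) with hD_def
  have hD : IsDerivTower D := hf.isDerivTower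
  have hfD (x : ℝ) : D 0 x = f x := by simp [hD_def]
  have hDpos (n : ℕ) (x : ℝ) (hx : 0 < x) : 0 ≤ (-1 : ℝ) ^ n * D n x := by
    have := hpos n 0 x hx
    simpa [Fst, div_self (Nat.cast_ne_zero.2 n.factorial_ne_zero : (n.factorial : ℝ) ≠ 0)] using this
  obtain ⟨μ, hμ, hmom⟩ := exists_measure_moment_eq
    (b := fun n => (-1) ^ n * D n 1 / (n.factorial : ℝ)) (fun n k => by
      have h : Fst f n k 1 = (n + k).factorial * ∑ j ∈ Finset.range (k + 1),
          (k.choose j : ℝ) * ((-1) ^ j * ((-1) ^ (n + j) * D (n + j) 1 /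
            ((n + j).factorial : ℝ))) := by
        rw [Fst, Finset.mul_sum, Finset.mul_sum]
        refine Finset.sum_congr rfl fun j _ => ?_
        have hs : (-1 : ℝ) ^ j * (-1) ^ j = 1 := by rw [← mul_pow]; simp
        change (-1 : ℝ) ^ n * (_ * D (n + j) 1) = _
        rw [pow_add]
        linear_combination -(((n + k).factorial : ℝ) * (k.choose j : ℝ) * (-1) ^ n * D (n + j) 1 /
            ((n + j).factorial : ℝ)) * hs
      have h0 := hpos n k 1 one_pos
      rw [h] at h0
      exact nonneg_of_mul_nonneg_right h0 (by positivity))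
  obtain ⟨C, ρ, hC, hρ, hint, hint_eq⟩ := exists_measure_integral_inv_add_pow μ
  have hE := isDerivTower_stieltjesDeriv C hρ hint
  have hEpos (n : ℕ) (x : ℝ) (hx : 0 < x) : 0 ≤ (-1 : ℝ) ^ n * stieltjesDeriv C ρ n x := by
    have := sum_stieltjesDeriv_nonneg hC hρ hint n 0 hx
    simpa [div_self (Nat.cast_ne_zero.2 n.factorial_ne_zero : (n.factorial : ℝ) ≠ 0)] using this
  have hone (n : ℕ) : D n 1 = stieltjesDeriv C ρ n 1 := by
    have hs : (-1 : ℝ) ^ n * (-1) ^ n = 1 := by rw [← mul_pow]; simp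
    rw [stieltjesDeriv, hint_eq, hmom]
    field_simp
    linear_combination -(D n 1) * hs
  refine ⟨C, ρ, hC, hρ, by simpa only [Real.rpow_neg_one] using hint, fun x hx => ?_⟩
  rw [← hfD, hD.eqOn_of_eq_at_one hE hDpos hEpos hone hx, stieltjesDeriv_zero]

/-- `f` is a Stieltjes function iff `f` is `C^∞` on `(0,∞)` and all the
quantities `F_{n,k}(x)` are nonnegative for `n, k ≥ 0` and `x > 0`. -/
theorem stmt3 (f : ℝ → ℝ) :
    IsStieltjes f ↔
      (ContDiffOn ℝ (⊤ : ℕ∞) f (Set.Ioi 0) ∧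
        ∀ (n k : ℕ), ∀ x > (0 : ℝ), 0 ≤ Fst f n k x) :=
  ⟨fun h => h.contDiffOn_and_fst_nonneg, fun h => isStieltjes_of_fst_nonneg h.1 h.2⟩
end

section
/- Let f : (0,∞) → ℝ. Then f is a Stieltjes function (i.e. a generalized Stieltjes function of order 1) if and only if f is C^∞ and, with F_{n,k}(x) = (−1)^n Σ_{j=0}^{k} binom(k,j) ((n+k)!/(n+j)!) x^j f^{(n+j)}(x), one has F_{0,0}(x) ≥ 0 for all x > 0 and F_{k−1,k}(x) ≥ 0 for all integers k ≥ 1 and all x > 0. -/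
open MeasureTheory Set Filter

section DerivChain

/-- `a` is the sequence of successive derivatives of `a 0` on the half-line `(0,∞)`. -/
def IsDerivChain (a : ℕ → ℝ → ℝ) : Prop :=
  ∀ n, ∀ x > (0 : ℝ), HasDerivAt (a n) (a (n + 1) x) x

lemma IsDerivChain.shift {a : ℕ → ℝ → ℝ} (ha : IsDerivChain a) :
    IsDerivChain fun n => a (n + 1) := fun n x hx => ha (n + 1) x hx

lemma IsDerivChain.neg {a : ℕ → ℝ → ℝ} (ha : IsDerivChain a) :
    IsDerivChain fun n x => -a n x := fun n x hx => (ha n x hx).neg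

lemma IsDerivChain.const_mul {a : ℕ → ℝ → ℝ} (ha : IsDerivChain a) (c : ℝ) :
    IsDerivChain fun n x => c * a n x := fun n x hx => (ha n x hx).const_mul c

lemma IsDerivChain.of_contDiffOn {f : ℝ → ℝ} (hf : ContDiffOn ℝ (⊤ : ℕ∞) f (Ioi 0)) :
    IsDerivChain fun n => iteratedDerivWithin n f (Ioi 0) := by
  intro n x hx
  have h := hf.differentiableOn_iteratedDerivWithin (m := n) (by exact_mod_cast WithTop.coe_lt_top n)
    (uniqueDiffOn_Ioi 0)
  have h1 := (h x hx).hasDerivWithinAt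
  rw [← iteratedDerivWithin_succ] at h1
  exact h1.hasDerivAt (Ioi_mem_nhds hx)

lemma IsDerivChain.iteratedDerivWithin_eq {a : ℕ → ℝ → ℝ} (ha : IsDerivChain a) {f : ℝ → ℝ}
    (hf : ∀ x > (0 : ℝ), f x = a 0 x) (n : ℕ) :
    ∀ x > (0 : ℝ), iteratedDerivWithin n f (Ioi 0) x = a n x := by
  induction n with
  | zero => simpa using hf
  | succ n ih =>
    intro x hx
    rw [iteratedDerivWithin_succ, derivWithin_congr (s := Ioi 0) (fun y hy => ih y hy) (ih x hx)]
    exact (ha n x hx).hasDerivWithinAt.derivWithin (uniqueDiffOn_Ioi 0 x hx)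

lemma IsDerivChain.contDiffOn {a : ℕ → ℝ → ℝ} (ha : IsDerivChain a) {f : ℝ → ℝ}
    (hf : ∀ x > (0 : ℝ), f x = a 0 x) : ContDiffOn ℝ (⊤ : ℕ∞) f (Ioi 0) := by
  refine contDiffOn_of_differentiableOn_deriv fun m _ => ?_
  refine DifferentiableOn.congr (f := a m) (fun x hx => ?_) (ha.iteratedDerivWithin_eq hf m)
  exact (ha m x hx).differentiableAt.differentiableWithinAt

lemma monotoneOn_of_hasDerivAt_nonneg {f f' : ℝ → ℝ} {D : Set ℝ} (hD : Convex ℝ D)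
    (hf : ∀ x ∈ D, HasDerivAt f (f' x) x) (hf' : ∀ x ∈ D, 0 ≤ f' x) : MonotoneOn f D := by
  refine monotoneOn_of_deriv_nonneg hD (fun x hx => (hf x hx).continuousAt.continuousWithinAt)
    (fun x hx => (hf x (interior_subset hx)).differentiableAt.differentiableWithinAt)
    fun x hx => ?_
  rw [(hf x (interior_subset hx)).deriv]
  exact hf' x (interior_subset hx)

lemma antitoneOn_of_hasDerivAt_nonpos {f f' : ℝ → ℝ} {D : Set ℝ} (hD : Convex ℝ D)
    (hf : ∀ x ∈ D, HasDerivAt f (f' x) x) (hf' : ∀ x ∈ D, f' x ≤ 0) : AntitoneOn f D := by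
  have := monotoneOn_of_hasDerivAt_nonneg (f := fun x => -f x) (f' := fun x => -f' x) hD
    (fun x hx => (hf x hx).neg) (fun x hx => by linarith [hf' x hx])
  intro x hx y hy hxy
  have := this hx hy hxy
  simp only at this
  linarith

/-- The successive derivatives of `x ↦ x ^ k * a 0 x`, by the Leibniz rule. -/
def powMulChain (a : ℕ → ℝ → ℝ) : ℕ → ℕ → ℝ → ℝ
  | 0, m => a m
  | k + 1, m => fun x => x * powMulChain a k m x + m * powMulChain a k (m - 1) x

lemma isDerivChain_powMulChain {a : ℕ → ℝ → ℝ} (ha : IsDerivChain a) (k : ℕ) :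
    IsDerivChain (powMulChain a k) := by
  induction k with
  | zero => exact ha
  | succ k ih =>
    intro m x hx
    have h1 := (hasDerivAt_id x).mul (ih m x hx)
    rcases m with _ | m
    · refine (h1.add ((hasDerivAt_const x (0 : ℝ)))).congr_deriv ?_ |>.congr_of_eventuallyEq ?_
      · simp [powMulChain]; ring
      · filter_upwards with y
        simp [powMulChain]
    · refine (h1.add ((ih m x hx).const_mul ((m + 1 : ℕ) : ℝ))).congr_deriv ?_
        |>.congr_of_eventuallyEq ?_
      · simp [powMulChain]; ring
      · filter_upwards with y
        simp [powMulChain]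

lemma powMulChain_zero (a : ℕ → ℝ → ℝ) (k : ℕ) (x : ℝ) : powMulChain a k 0 x = x ^ k * a 0 x := by
  induction k with
  | zero => simp [powMulChain]
  | succ k ih => simp [powMulChain, ih]; ring

/-- The expression `F_{n,k}` formed from a sequence of derivatives. -/
noncomputable def chainF (a : ℕ → ℝ → ℝ) (n k : ℕ) (x : ℝ) : ℝ :=
  (-1 : ℝ) ^ n * powMulChain a k (n + k) x

lemma chainF_zero_right (a : ℕ → ℝ → ℝ) (n : ℕ) (x : ℝ) :
    chainF a n 0 x = (-1 : ℝ) ^ n * a n x := rfl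

lemma chainF_succ_right (a : ℕ → ℝ → ℝ) (n k : ℕ) (x : ℝ) :
    chainF a n (k + 1) x = -(x * chainF a (n + 1) k x) + (n + k + 1) * chainF a n k x := by
  have : n + (k + 1) - 1 = n + k := by omega
  simp only [chainF, powMulChain, this, show n + 1 + k = n + (k + 1) by ring]
  push_cast
  ring

lemma IsDerivChain.hasDerivAt_chainF {a : ℕ → ℝ → ℝ} (ha : IsDerivChain a) (n k : ℕ) {x : ℝ}
    (hx : 0 < x) : HasDerivAt (chainF a n k) (-chainF a (n + 1) k x) x := by
  refine ((isDerivChain_powMulChain ha k (n + k) x hx).const_mul ((-1 : ℝ) ^ n)).congr_deriv ?_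
  simp only [chainF, show n + 1 + k = n + k + 1 by ring]
  ring

lemma chainF_eq_sum (a : ℕ → ℝ → ℝ) (n k : ℕ) (x : ℝ) :
    chainF a n k x = (-1 : ℝ) ^ n * ∑ j ∈ Finset.range (k + 1),
      (k.choose j : ℝ) * (((n + k).factorial : ℝ) / ((n + j).factorial : ℝ)) *
        x ^ j * a (n + j) x := by
  induction k generalizing n with
  | zero =>
    simp [chainF, powMulChain, Nat.factorial_ne_zero]
  | succ k ih =>
    rw [chainF_succ_right, ih, ih, Finset.sum_range_succ' _ (k + 1)]
    have e1 : ∀ j, ((k + 1).choose (j + 1) : ℝ) = k.choose j + k.choose (j + 1) := fun j => by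
      rw [Nat.choose_succ_succ]; push_cast; ring
    have e2 : (((n + (k + 1)).factorial : ℕ) : ℝ) = (n + k + 1) * (n + k).factorial := by
      rw [← add_assoc, Nat.factorial_succ]; push_cast; ring
    have e3 : ∑ j ∈ Finset.range (k + 1), (k.choose j : ℝ) * (((n + k).factorial : ℝ) /
        ((n + j).factorial : ℝ)) * x ^ j * a (n + j) x =
        (∑ j ∈ Finset.range (k + 1), (k.choose (j + 1) : ℝ) * (((n + k).factorial : ℝ) /
        ((n + (j + 1)).factorial : ℝ)) * x ^ (j + 1) * a (n + (j + 1)) x) +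
        ((n + k).factorial : ℝ) / (n.factorial : ℝ) * a n x := by
      have h1 := Finset.sum_range_succ' (fun j => (k.choose j : ℝ) * (((n + k).factorial : ℝ) /
        ((n + j).factorial : ℝ)) * x ^ j * a (n + j) x) (k + 1)
      rw [Finset.sum_range_succ] at h1
      simpa using h1
    have e4 : x * ∑ j ∈ Finset.range (k + 1), (k.choose j : ℝ) *
        (((n + 1 + k).factorial : ℝ) / ((n + 1 + j).factorial : ℝ)) * x ^ j * a (n + 1 + j) x =
        (n + k + 1) * ∑ j ∈ Finset.range (k + 1), (k.choose j : ℝ) *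
        (((n + k).factorial : ℝ) / ((n + (j + 1)).factorial : ℝ)) * x ^ (j + 1) *
          a (n + (j + 1)) x := by
      rw [Finset.mul_sum, Finset.mul_sum]
      refine Finset.sum_congr rfl fun j _ => ?_
      rw [show n + 1 + j = n + (j + 1) by ring, show n + 1 + k = n + (k + 1) by ring, e2]
      ring
    have e5 : ∑ j ∈ Finset.range (k + 1), ((k + 1).choose (j + 1) : ℝ) *
        (((n + (k + 1)).factorial : ℝ) / ((n + (j + 1)).factorial : ℝ)) * x ^ (j + 1) *
          a (n + (j + 1)) x =
        (n + k + 1) * ∑ j ∈ Finset.range (k + 1), (k.choose j : ℝ) *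
        (((n + k).factorial : ℝ) / ((n + (j + 1)).factorial : ℝ)) * x ^ (j + 1) *
          a (n + (j + 1)) x + (n + k + 1) * ∑ j ∈ Finset.range (k + 1), (k.choose (j + 1) : ℝ) *
        (((n + k).factorial : ℝ) / ((n + (j + 1)).factorial : ℝ)) * x ^ (j + 1) *
          a (n + (j + 1)) x := by
      rw [Finset.mul_sum, Finset.mul_sum, ← Finset.sum_add_distrib]
      refine Finset.sum_congr rfl fun j _ => ?_
      rw [e1, e2]
      ring
    rw [e3, e5, e2, mul_left_comm x, e4, pow_succ]
    simp only [Nat.choose_zero_right, add_zero, pow_zero, Nat.cast_one]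
    ring

lemma Fst_eq_chainF (f : ℝ → ℝ) (n k : ℕ) :
    Fst f n k = chainF (fun n => iteratedDerivWithin n f (Ioi 0)) n k := by
  funext x
  rw [chainF_eq_sum, Fst]

end DerivChain

section Descent

lemma IsDerivChain.exists_const_mul_pow_le {w : ℕ → ℝ → ℝ} (hw : IsDerivChain w) (N : ℕ) :
    ∀ j, (∃ c > 0, ∀ᶠ x in atTop, c * x ^ j ≤ w N x) →
      ∃ c > 0, ∀ᶠ x in atTop, c * x ^ (j + N) ≤ w 0 x := by
  induction N with
  | zero => exact fun j h => h
  | succ N ih =>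
    rintro j ⟨c, hc, h⟩
    rw [show j + (N + 1) = j + 1 + N by ring]
    refine ih (j + 1) ?_
    obtain ⟨X, hX0, hX⟩ : ∃ X > (0 : ℝ), ∀ x ≥ X, c * x ^ j ≤ w (N + 1) x := by
      obtain ⟨X, hX⟩ := eventually_atTop.1 h
      exact ⟨max X 1, by positivity, fun x hx => hX x (le_trans (le_max_left _ _) hx)⟩
    have hmono : MonotoneOn (fun x => w N x - c / (j + 1) * x ^ (j + 1)) (Ici X) := by
      refine monotoneOn_of_hasDerivAt_nonneg (f' := fun x => w (N + 1) x - c * x ^ j)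
        (convex_Ici X) (fun x hx => ?_) (fun x hx => sub_nonneg.2 (hX x hx))
      refine ((hw N x (hX0.trans_le hx)).sub
        ((hasDerivAt_pow (j + 1) x).const_mul (c / (j + 1)))).congr_deriv ?_
      have : (j : ℝ) + 1 ≠ 0 := by positivity
      simp
      field_simp
    have hj : (0 : ℝ) < c / (j + 1) := by positivity
    have hlim : Tendsto (fun x : ℝ => c / (j + 1) / 2 * x ^ (j + 1)) atTop atTop :=
      (tendsto_pow_atTop (by omega)).const_mul_atTop (by positivity)
    refine ⟨c / (j + 1) / 2, by positivity, ?_⟩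
    filter_upwards [eventually_ge_atTop X,
      hlim.eventually_ge_atTop (-(w N X - c / (j + 1) * X ^ (j + 1)))] with x hx hx2
    have := hmono (mem_Ici.2 le_rfl) hx hx
    simp only at this
    linarith

lemma IsDerivChain.exists_const_mul_inv_pow_le {N : ℕ} :
    ∀ {w : ℕ → ℝ → ℝ}, IsDerivChain w → ∀ {j : ℕ},
      (∃ c > 0, ∃ δ > 0, ∀ x ∈ Ioo (0 : ℝ) δ, c * x⁻¹ ^ (j + 1 + N) ≤ (-1) ^ N * w N x) →
      ∃ c > 0, ∃ δ > 0, ∀ x ∈ Ioo (0 : ℝ) δ, c * x⁻¹ ^ (j + 1) ≤ w 0 x := by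
  induction N with
  | zero => intro w _ j h; simpa using h
  | succ N ih =>
    rintro w hw j h
    have h1 := ih (j := j + 1) (hw.shift.neg)
      (by simpa [pow_succ, show j + 1 + (N + 1) = j + 1 + 1 + N by ring] using h)
    obtain ⟨c, hc, δ, hδ, h⟩ := h1
    have hj : (0 : ℝ) < c / (j + 1) := by positivity
    have hanti : AntitoneOn (fun x => w 0 x - c / (j + 1) * x⁻¹ ^ (j + 1)) (Ioo 0 δ) := by
      refine antitoneOn_of_hasDerivAt_nonpos (f' := fun x => w 1 x + c * x⁻¹ ^ (j + 1 + 1))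
        (convex_Ioo 0 δ) (fun x hx => ?_) (fun x hx => by linarith [h x hx])
      refine ((hw 0 x hx.1).sub
        (((hasDerivAt_inv hx.1.ne').pow (j + 1)).const_mul (c / (j + 1)))).congr_deriv ?_
      have : (j : ℝ) + 1 ≠ 0 := by positivity
      have := hx.1.ne'
      simp
      field_simp
      ring
    have hlim : Tendsto (fun x : ℝ => c / (j + 1) / 2 * x⁻¹ ^ (j + 1)) (nhdsWithin 0 (Ioi 0)) atTop :=
      ((tendsto_pow_atTop (by omega)).comp tendsto_inv_nhdsGT_zero).const_mul_atTop (by positivity)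
    have hev : ∀ᶠ x in nhdsWithin (0 : ℝ) (Ioi 0), c / (j + 1) / 2 * x⁻¹ ^ (j + 1) ≤ w 0 x := by
      filter_upwards [Ioo_mem_nhdsGT (half_pos hδ),
        hlim.eventually_ge_atTop (-(w 0 (δ / 2) - c / (j + 1) * (δ / 2)⁻¹ ^ (j + 1)))] with x hx hx2
      have := hanti ⟨hx.1, by linarith [hx.2]⟩ ⟨half_pos hδ, half_lt_self hδ⟩ hx.2.le
      simp only at this
      linarith
    obtain ⟨ε, hε, hsub⟩ := mem_nhdsGT_iff_exists_Ioo_subset.1 hev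
    exact ⟨c / (j + 1) / 2, by positivity, ε, hε, fun x hx => hsub hx⟩

variable {a : ℕ → ℝ → ℝ}

lemma IsDerivChain.chainF_nonneg_of_succ_left (ha : IsDerivChain a) (h0 : ∀ x > 0, 0 ≤ a 0 x)
    {M : ℝ} (hM : ∀ x ≥ 1, a 0 x ≤ M) {n k : ℕ}
    (h : ∀ x > 0, 0 ≤ chainF a (n + 1) k x) : ∀ x > 0, 0 ≤ chainF a n k x := by
  by_contra! hcon
  obtain ⟨x₀, hx₀, hneg⟩ := hcon
  have hanti : AntitoneOn (chainF a n k) (Ioi 0) :=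
    antitoneOn_of_hasDerivAt_nonpos (convex_Ioi 0) (fun x hx => ha.hasDerivAt_chainF n k hx)
      (fun x hx => by linarith [h x hx])
  have hw : IsDerivChain fun m x => (-1 : ℝ) ^ (n + 1) * powMulChain a k m x :=
    (isDerivChain_powMulChain ha k).const_mul _
  obtain ⟨c, hc, hev⟩ := hw.exists_const_mul_pow_le (n + k) 0
    ⟨-chainF a n k x₀, by linarith, by
      filter_upwards [eventually_ge_atTop x₀] with x hx
      have := hanti hx₀ (hx₀.trans_le hx) hx
      simp only [chainF] at this ⊢
      rw [pow_succ]
      linarith⟩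
  have hev' : ∀ᶠ x in atTop, c * x ^ n ≤ (-1 : ℝ) ^ (n + 1) * a 0 x := by
    filter_upwards [hev, eventually_gt_atTop 0] with x hx hx0
    rw [powMulChain_zero, zero_add, pow_add] at hx
    have hk : 0 < x ^ k := pow_pos hx0 k
    refine le_of_mul_le_mul_right ?_ hk
    linarith
  rcases Nat.even_or_odd n with hn | hn
  · obtain ⟨x, hx, hx0⟩ := (hev'.and (eventually_gt_atTop 0)).exists
    rw [hn.add_one.neg_one_pow] at hx
    have : 0 < c * x ^ n := by positivity
    linarith [h0 x hx0]
  · have hlim : Tendsto (fun x : ℝ => c * x ^ n) atTop atTop :=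
      (tendsto_pow_atTop hn.pos.ne').const_mul_atTop hc
    obtain ⟨x, ⟨hx, hx1⟩, hx2⟩ :=
      ((hev'.and (eventually_ge_atTop 1)).and (hlim.eventually_gt_atTop M)).exists
    rw [hn.add_one.neg_one_pow] at hx
    linarith [hM x hx1]

lemma IsDerivChain.chainF_nonneg_of_succ_right (ha : IsDerivChain a) (h0 : ∀ x > 0, 0 ≤ a 0 x)
    {M : ℝ} (hM : ∀ x > 0, x ≤ 1 → x * a 0 x ≤ M) {n k : ℕ}
    (h : ∀ x > 0, 0 ≤ chainF a n (k + 1) x) : ∀ x > 0, 0 ≤ chainF a n k x := by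
  by_contra! hcon
  obtain ⟨x₀, hx₀, hneg⟩ := hcon
  have hmono : MonotoneOn (fun x => x ^ (n + k + 1) * chainF a n k x) (Ioi 0) := by
    refine monotoneOn_of_hasDerivAt_nonneg (f' := fun x => x ^ (n + k) * chainF a n (k + 1) x)
      (convex_Ioi 0) (fun x hx => ?_) (fun x hx => mul_nonneg (pow_pos hx _).le (h x hx))
    refine ((hasDerivAt_pow (n + k + 1) x).mul (ha.hasDerivAt_chainF n k hx)).congr_deriv ?_
    rw [chainF_succ_right]
    simp
    ring
  have hw : IsDerivChain fun m x => (-1 : ℝ) ^ (k + 1) * powMulChain a k m x :=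
    (isDerivChain_powMulChain ha k).const_mul _
  obtain ⟨c, hc, δ, hδ, hev⟩ := hw.exists_const_mul_inv_pow_le (N := n + k) (j := 0)
    ⟨-(x₀ ^ (n + k + 1) * chainF a n k x₀),
      neg_pos.2 (mul_neg_of_pos_of_neg (pow_pos hx₀ _) hneg), x₀, hx₀, fun x hx => by
      have h1 := hmono hx.1 hx₀ hx.2.le
      have hp : 0 < x ^ (n + k + 1) := pow_pos hx.1 _
      simp only at h1
      rw [zero_add, add_comm 1, inv_pow, ← div_eq_mul_inv, div_le_iff₀ hp]
      have e : (-1 : ℝ) ^ (n + k) * ((-1) ^ (k + 1) * powMulChain a k (n + k) x) =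
          -chainF a n k x := by
        have : (-1 : ℝ) ^ k * (-1) ^ k = 1 := by rw [← mul_pow]; simp
        simp only [chainF, pow_add, pow_one]
        linear_combination (-(-1) ^ n * powMulChain a k (n + k) x) * this
      rw [e]
      linarith⟩
  have hev' : ∀ x ∈ Ioo 0 δ, c ≤ (-1 : ℝ) ^ (k + 1) * (x ^ k * (x * a 0 x)) := by
    intro x hx
    have := hev x hx
    rw [powMulChain_zero, zero_add, pow_one, ← div_eq_mul_inv, div_le_iff₀ hx.1] at this
    linarith
  rcases Nat.even_or_odd k with hk | hk
  · have hx := hev' (δ / 2) ⟨half_pos hδ, half_lt_self hδ⟩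
    rw [hk.add_one.neg_one_pow] at hx
    have := mul_nonneg (pow_pos (half_pos hδ) k).le
      (mul_nonneg (half_pos hδ).le (h0 _ (half_pos hδ)))
    linarith
  · have hM0 : 0 ≤ M := by
      have := hM 1 one_pos le_rfl
      linarith [h0 1 one_pos]
    set x := min (min (δ / 2) 1) (c / (2 * (M + 1))) with hxdef
    have hx0 : 0 < x := by positivity
    have hx1 : x ≤ 1 := (min_le_left _ _).trans (min_le_right _ _)
    have hx2 : x < δ := ((min_le_left _ _).trans (min_le_left _ _)).trans_lt (half_lt_self hδ)
    have hx3 : x * (2 * (M + 1)) ≤ c := by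
      rw [← le_div_iff₀ (by positivity)]
      exact min_le_right _ _
    have hx := hev' x ⟨hx0, hx2⟩
    rw [hk.add_one.neg_one_pow, one_mul] at hx
    have h1 : x ^ k ≤ x := pow_le_of_le_one hx0.le hx1 hk.pos.ne'
    have h2 : x ^ k * (x * a 0 x) ≤ x * M :=
      mul_le_mul h1 (hM x hx0 hx1) (mul_nonneg hx0.le (h0 x hx0)) hx0.le
    nlinarith

/-- The diagonal conditions of Widder imply that all `F_{n,k}` are nonnegative. -/
lemma IsDerivChain.chainF_nonneg (ha : IsDerivChain a) (h0 : ∀ x > 0, 0 ≤ a 0 x)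
    (h : ∀ k, ∀ x > 0, 0 ≤ chainF a k (k + 1) x) (n k : ℕ) : ∀ x > 0, 0 ≤ chainF a n k x := by
  have hM1 : ∀ x > 0, x ≤ 1 → x * a 0 x ≤ a 0 1 := by
    have hmono : MonotoneOn (fun x => x * a 0 x) (Ioi 0) := by
      refine monotoneOn_of_hasDerivAt_nonneg (f' := chainF a 0 1) (convex_Ioi 0) (fun x hx => ?_)
        (h 0)
      refine ((hasDerivAt_id x).mul (ha 0 x hx)).congr_deriv ?_
      simp [chainF, powMulChain]
      ring
    intro x hx hx1
    simpa using hmono hx (mem_Ioi.2 one_pos) hx1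
  have hright : ∀ n k, (∀ x > 0, 0 ≤ chainF a n (k + 1) x) → ∀ x > 0, 0 ≤ chainF a n k x :=
    fun n k => ha.chainF_nonneg_of_succ_right h0 hM1
  have hM2 : ∀ x ≥ 1, a 0 x ≤ a 0 1 := by
    have hanti : AntitoneOn (a 0) (Ioi 0) :=
      antitoneOn_of_hasDerivAt_nonpos (convex_Ioi 0) (fun x hx => ha 0 x hx) fun x hx => by
        have := hright 1 0 (hright 1 1 (h 1)) x hx
        simp only [chainF_zero_right] at this
        linarith
    exact fun x hx => hanti (mem_Ioi.2 one_pos) (mem_Ioi.2 (by linarith)) hx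
  have hleft : ∀ n k, (∀ x > 0, 0 ≤ chainF a (n + 1) k x) → ∀ x > 0, 0 ≤ chainF a n k x :=
    fun n k => ha.chainF_nonneg_of_succ_left h0 hM2
  have hdiag : ∀ x > 0, 0 ≤ chainF a (n + k) k x := by
    have : ∀ m, (∀ x > 0, 0 ≤ chainF a (n + k) (k + m) x) →
        ∀ x > 0, 0 ≤ chainF a (n + k) k x := by
      intro m
      induction m with
      | zero => exact id
      | succ m ih => exact fun hm => ih (hright _ _ hm)
    exact this (n + 1) (by simpa [show k + (n + 1) = n + k + 1 by ring] using h (n + k))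
  have : ∀ m, (∀ x > 0, 0 ≤ chainF a (n + m) k x) → ∀ x > 0, 0 ≤ chainF a n k x := by
    intro m
    induction m with
    | zero => exact id
    | succ m ih => exact fun hm => ih (hleft _ _ hm)
  exact this k hdiag

end Descent

section Uniqueness

lemma abs_le_mul_pow_div_factorial {n : ℕ} {K : ℝ} :
    ∀ {e : ℕ → ℝ → ℝ}, (∀ m, ∀ s ∈ Icc (0 : ℝ) 1, HasDerivAt (e m) (e (m + 1) s) s) →
      (∀ m, e m 0 = 0) → (∀ s ∈ Icc (0 : ℝ) 1, |e n s| ≤ K) →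
      ∀ s ∈ Icc (0 : ℝ) 1, |e 0 s| ≤ K * s ^ n / n.factorial := by
  induction n with
  | zero => intro e _ _ hK; simpa using hK
  | succ n ih =>
    intro e he h0 hK s hs
    have h1 := ih (e := fun m => e (m + 1)) (fun m => he (m + 1)) (fun m => h0 (m + 1)) hK
    have hd : ∀ s, HasDerivAt (fun s : ℝ => K * s ^ (n + 1) / (n + 1).factorial)
        (K * s ^ n / n.factorial) s := fun s => by
      refine (((hasDerivAt_pow (n + 1) s).const_mul K).div_const _).congr_deriv ?_
      rw [Nat.factorial_succ]
      push_cast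
      have : (n.factorial : ℝ) ≠ 0 := by positivity
      have : (n : ℝ) + 1 ≠ 0 := by positivity
      field_simp
    have hz : (0 : ℝ) ∈ Icc (0 : ℝ) 1 := ⟨le_rfl, zero_le_one⟩
    have m1 := monotoneOn_of_hasDerivAt_nonneg (convex_Icc 0 1)
      (fun s hs => (hd s).sub (he 0 s hs))
      (fun s hs => by simp only [zero_add]; linarith [(abs_le.1 (h1 s hs)).2]) hz hs hs.1
    have m2 := monotoneOn_of_hasDerivAt_nonneg (convex_Icc 0 1)
      (fun s hs => (hd s).add (he 0 s hs))
      (fun s hs => by simp only [zero_add]; linarith [(abs_le.1 (h1 s hs)).1]) hz hs hs.1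
    simp only [h0, Pi.sub_apply, Pi.add_apply, ne_eq, Nat.succ_ne_zero, not_false_eq_true, zero_pow,
      mul_zero, zero_div, sub_zero, add_zero]
      at m1 m2
    exact abs_le.2 ⟨by linarith, by linarith⟩

lemma IsDerivChain.alternating_le {n : ℕ} :
    ∀ {a : ℕ → ℝ → ℝ}, IsDerivChain a → (∀ n, ∀ x > 0, 0 ≤ (-1) ^ n * a n x) →
      ∀ {c x : ℝ}, 0 < x → x ≤ c → (-1) ^ n * a n c / n.factorial * (c - x) ^ n ≤ a 0 x := by
  induction n with
  | zero =>
    intro a ha hcm c x hx hxc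
    have := antitoneOn_of_hasDerivAt_nonpos (convex_Ioi 0) (fun x hx => ha 0 x hx)
      (fun x hx => by have := hcm 1 x hx; linarith) (mem_Ioi.2 hx) (mem_Ioi.2 (hx.trans_le hxc)) hxc
    simpa using this
  | succ n ih =>
    intro a ha hcm c x hx hxc
    set B := (-1) ^ (n + 1) * a (n + 1) c / n.factorial with hB
    have h1 : ∀ y ∈ Ioc 0 c, a 1 y + B * (c - y) ^ n ≤ 0 := fun y hy => by
      have := ih (a := fun n x => -a (n + 1) x) ha.shift.neg
        (fun m z hz => by have := hcm (m + 1) z hz; rw [pow_succ] at this; linarith) hy.1 hy.2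
      rw [hB, pow_succ]
      simp only [zero_add] at this
      have e : (-1) ^ n * -a (n + 1) c / n.factorial =
        (-1) ^ n * -1 * a (n + 1) c / (n.factorial : ℝ) := by ring
      rw [e] at this
      linarith
    have hd : ∀ y ∈ Ioc 0 c, HasDerivAt (fun y => a 0 y - B / (n + 1) * (c - y) ^ (n + 1))
        (a 1 y + B * (c - y) ^ n) y := fun y hy => by
      refine ((ha 0 y hy.1).sub
        ((((hasDerivAt_id y).const_sub c).pow (n + 1)).const_mul (B / (n + 1)))).congr_deriv ?_
      have : (n : ℝ) + 1 ≠ 0 := by positivity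
      simp
      field_simp
    have hcx : 0 < c := hx.trans_le hxc
    have := antitoneOn_of_hasDerivAt_nonpos (convex_Ioc 0 c) hd h1 ⟨hx, hxc⟩ ⟨hcx, le_rfl⟩ hxc
    have h0 := hcm 0 c hcx
    simp only [sub_self, pow_zero, one_mul, ne_eq, Nat.add_eq_zero_iff, one_ne_zero, and_false,
      not_false_eq_true, zero_pow, mul_zero, sub_zero] at this h0
    have e : (-1) ^ (n + 1) * a (n + 1) c / ((n + 1).factorial : ℝ) = B / (n + 1) := by
      rw [hB, Nat.factorial_succ]
      push_cast
      field_simp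
    rw [e]
    linarith

variable {a b : ℕ → ℝ → ℝ}

lemma IsDerivChain.abs_le_of_alternating (ha : IsDerivChain a)
    (hcm : ∀ n, ∀ x > 0, 0 ≤ (-1) ^ n * a n x) {c y : ℝ} (hc : 0 < c) (hy : 3 * c / 4 ≤ y) (n : ℕ) :
    |a n y| ≤ n.factorial * a 0 (c / 2) * (4 / c) ^ n := by
  have hy0 : 0 < y := by linarith
  have h := ha.alternating_le (n := n) hcm (half_pos hc) (by linarith : c / 2 ≤ y)
  have e : |a n y| = (-1) ^ n * a n y := by
    rw [← abs_of_nonneg (hcm n y hy0), abs_mul]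
    simp
  have hle : (c / 4) ^ n ≤ (y - c / 2) ^ n := pow_le_pow_left₀ (by positivity) (by linarith) n
  have hnn : 0 ≤ |a n y| / n.factorial := by positivity
  rw [← e] at h
  have h2 : |a n y| / n.factorial * (c / 4) ^ n ≤ a 0 (c / 2) :=
    (mul_le_mul_of_nonneg_left hle hnn).trans h
  have h3 : (c / 4) ^ n * (4 / c) ^ n = 1 := by
    rw [← mul_pow, div_mul_div_cancel₀ (by norm_num), div_self hc.ne', one_pow]
  have hf : (0 : ℝ) < n.factorial := by positivity
  calc |a n y| = n.factorial * (|a n y| / n.factorial * (c / 4) ^ n) * (4 / c) ^ n := by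
        rw [mul_assoc, mul_assoc _ ((c / 4) ^ n), h3]
        field_simp
    _ ≤ n.factorial * a 0 (c / 2) * (4 / c) ^ n := by gcongr

lemma IsDerivChain.eq_of_forall_eq_of_abs_sub_le (ha : IsDerivChain a) (hb : IsDerivChain b)
    (hacm : ∀ n, ∀ x > 0, 0 ≤ (-1) ^ n * a n x) (hbcm : ∀ n, ∀ x > 0, 0 ≤ (-1) ^ n * b n x)
    {c : ℝ} (hc : 0 < c) (hab : ∀ n, a n c = b n c) {x : ℝ} (hx : |x - c| ≤ c / 8) :
    a 0 x = b 0 x := by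
  have hpos : ∀ s ∈ Icc (0 : ℝ) 1, 3 * c / 4 ≤ c + s * (x - c) := fun s hs => by
    have h1 : |s * (x - c)| ≤ c / 8 := by
      rw [abs_mul, abs_of_nonneg hs.1]
      exact (mul_le_of_le_one_left (abs_nonneg _) hs.2).trans hx
    linarith [(abs_le.1 h1).1]
  set A := a 0 (c / 2) + b 0 (c / 2)
  set e : ℕ → ℝ → ℝ := fun n s => (x - c) ^ n * (a n (c + s * (x - c)) - b n (c + s * (x - c)))
  have he : ∀ m, ∀ s ∈ Icc (0 : ℝ) 1, HasDerivAt (e m) (e (m + 1) s) s := fun m s hs => by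
    have hp : 0 < c + s * (x - c) := by linarith [hpos s hs]
    have hlin : HasDerivAt (fun s : ℝ => c + s * (x - c)) (x - c) s := by
      simpa using ((hasDerivAt_id s).mul_const (x - c)).const_add c
    refine ((((ha m _ hp).sub (hb m _ hp)).comp s hlin).const_mul ((x - c) ^ m)).congr_deriv ?_
    simp only [e, pow_succ]
    ring
  have hbound : ∀ n, |a 0 x - b 0 x| ≤ A * (1 / 2) ^ n := fun n => by
    have h := abs_le_mul_pow_div_factorial (n := n) (K := n.factorial * (A * (1 / 2) ^ n)) he
      (fun m => by simp [e, hab]) (fun s hs => ?_) 1 ⟨zero_le_one, le_rfl⟩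
    · have hf : (n.factorial : ℝ) ≠ 0 := by positivity
      simpa [e, hf] using h
    · have h1 := ha.abs_le_of_alternating hacm hc (hpos s hs) n
      have h2 := hb.abs_le_of_alternating hbcm hc (hpos s hs) n
      have h3 : |(x - c) ^ n| ≤ (c / 8) ^ n := by
        rw [abs_pow]
        exact pow_le_pow_left₀ (abs_nonneg _) hx n
      have h4 : |a n (c + s * (x - c)) - b n (c + s * (x - c))| ≤
          n.factorial * A * (4 / c) ^ n := by
        refine (abs_sub _ _).trans ?_
        simp only [A]
        linarith
      have h5 : (c / 8) ^ n * (4 / c) ^ n = (1 / 2 : ℝ) ^ n := by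
        rw [← mul_pow]
        congr 1
        field_simp
        norm_num
      calc |e n s| ≤ (c / 8) ^ n * (n.factorial * A * (4 / c) ^ n) := by
            simp only [e]
            rw [abs_mul]
            exact mul_le_mul h3 h4 (abs_nonneg _) (by positivity)
        _ = n.factorial * (A * (1 / 2) ^ n) := by rw [← h5]; ring
  have hlim : Tendsto (fun n : ℕ => A * (1 / 2 : ℝ) ^ n) atTop (nhds (A * 0)) :=
    (tendsto_pow_atTop_nhds_zero_of_lt_one (by norm_num) (by norm_num)).const_mul A
  rw [mul_zero] at hlim
  have := ge_of_tendsto' hlim hbound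
  exact sub_eq_zero.1 (abs_nonpos_iff.1 this)

/-- Completely monotone functions on the half-line are determined by their jets at one point. -/
lemma IsDerivChain.eq_of_forall_eq (ha : IsDerivChain a) (hb : IsDerivChain b)
    (hacm : ∀ n, ∀ x > 0, 0 ≤ (-1) ^ n * a n x) (hbcm : ∀ n, ∀ x > 0, 0 ≤ (-1) ^ n * b n x)
    {c : ℝ} (hc : 0 < c) (hab : ∀ n, a n c = b n c) {x : ℝ} (hx : 0 < x) : a 0 x = b 0 x := by
  set S : Set ℝ := {x | 0 < x ∧ ∀ n, a n x = b n x}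
  have hopen : IsOpen S := by
    refine isOpen_iff_mem_nhds.2 fun y hy => ?_
    have hball : Metric.ball y (y / 8) ⊆ Ioi 0 := fun z hz => by
      have := (abs_lt.1 (Metric.mem_ball.1 hz)).1
      have := hy.1
      simp only [mem_Ioi]
      linarith
    have hall : ∀ n, ∀ z ∈ Metric.ball y (y / 8), a n z = b n z := by
      intro n
      induction n with
      | zero =>
        intro z hz
        exact ha.eq_of_forall_eq_of_abs_sub_le hb hacm hbcm hy.1 hy.2 (Metric.mem_ball.1 hz).le
      | succ n ih =>
        intro z hz
        refine ((ha n z (hball hz)).congr_of_eventuallyEq ?_).unique (hb n z (hball hz))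
        filter_upwards [Metric.isOpen_ball.mem_nhds hz] with u hu using (ih u hu).symm
    filter_upwards [Metric.ball_mem_nhds y (show 0 < y / 8 by linarith [hy.1])] with z hz
    exact ⟨hball hz, fun n => hall n z hz⟩
  have hclosed : closure S ∩ Ioi 0 ⊆ S := by
    rintro y ⟨hy, hy0⟩
    refine ⟨hy0, fun n => ?_⟩
    by_contra hne
    have hd := ((ha n y hy0).sub (hb n y hy0)).continuousAt.eventually_ne (sub_ne_zero.2 hne)
    obtain ⟨z, hz, hzS⟩ := ((mem_closure_iff_frequently.1 hy).and_eventually hd).exists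
    exact hzS (sub_eq_zero.2 (hz.2 n))
  exact (isPreconnected_Ioi.subset_of_closure_inter_subset hopen ⟨c, hc, hc, hab⟩ hclosed hx).2 0

end Uniqueness

section HausdorffMoment

lemma abs_pow_sub_descFactorial_mul_le {i N : ℕ} (hi : i ≤ N) (n : ℕ) :
    |(i : ℝ) ^ n - i.descFactorial n| * N ≤ n ^ 2 * (N : ℝ) ^ n := by
  have hiN : (i : ℝ) ≤ N := by exact_mod_cast hi
  induction n with
  | zero => simp
  | succ n ih =>
    have hd : ((i.descFactorial (n + 1) : ℕ) : ℝ) = (i - n) * i.descFactorial n := by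
      rcases le_or_gt n i with h | h
      · rw [Nat.descFactorial_succ]; push_cast [h]; ring
      · simp [Nat.descFactorial_succ, Nat.descFactorial_of_lt h]
    have hle : ((i.descFactorial n : ℕ) : ℝ) ≤ (N : ℝ) ^ n := by
      exact_mod_cast (Nat.descFactorial_le_pow i n).trans (Nat.pow_le_pow_left hi n)
    have e : (i : ℝ) ^ (n + 1) - i.descFactorial (n + 1) =
        i * ((i : ℝ) ^ n - i.descFactorial n) + n * i.descFactorial n := by rw [hd]; ring
    have hN : (0 : ℝ) ≤ N := by positivity
    calc |(i : ℝ) ^ (n + 1) - i.descFactorial (n + 1)| * N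
        ≤ (i * |(i : ℝ) ^ n - i.descFactorial n| + n * i.descFactorial n) * N := by
          rw [e]
          refine mul_le_mul_of_nonneg_right ((abs_add_le _ _).trans (le_of_eq ?_)) hN
          rw [abs_mul, Nat.abs_cast, abs_of_nonneg (by positivity : (0 : ℝ) ≤ n * _)]
      _ = i * (|(i : ℝ) ^ n - i.descFactorial n| * N) + n * i.descFactorial n * N := by ring
      _ ≤ N * (n ^ 2 * (N : ℝ) ^ n) + n * (N : ℝ) ^ n * N := by gcongr
      _ ≤ ((n + 1 : ℕ) : ℝ) ^ 2 * (N : ℝ) ^ (n + 1) := by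
          push_cast
          have : 0 ≤ (n + 1 : ℝ) * (N : ℝ) ^ (n + 1) := by positivity
          have e : (N : ℝ) * (n ^ 2 * (N : ℝ) ^ n) + n * (N : ℝ) ^ n * N =
            (n ^ 2 + n) * (N : ℝ) ^ (n + 1) := by ring
          rw [e]
          linarith

variable {D : ℕ → ℕ → ℝ}

lemma eq_sum_antidiagonal_choose_mul (h : ∀ n k, D n k = D (n + 1) k + D n (k + 1)) (N : ℕ) :
    ∀ n k, D n k = ∑ ij ∈ Finset.HasAntidiagonal.antidiagonal N, (N.choose ij.1 : ℝ) * D (n + ij.1) (k + ij.2) := by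
  induction N with
  | zero => simp
  | succ N ih =>
    intro n k
    rw [Finset.sum_antidiagonal_choose_succ_mul (fun i j => D (n + i) (k + j)), h n k,
      ih (n + 1) k, ih n (k + 1), add_comm]
    congr 1
    · refine Finset.sum_congr rfl fun ij _ => ?_
      rw [show k + 1 + ij.2 = k + (ij.2 + 1) by ring]
    · refine Finset.sum_congr rfl fun ij hij => ?_
      rw [show n + 1 + ij.1 = n + (ij.1 + 1) by ring,
        Nat.choose_symm_of_eq_add (Finset.HasAntidiagonal.mem_antidiagonal.1 hij).symm]

lemma sum_antidiagonal_choose_mul_descFactorial_mul (n : ℕ) :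
    ∀ {D : ℕ → ℕ → ℝ}, (∀ n k, D n k = D (n + 1) k + D n (k + 1)) → ∀ N : ℕ,
      ∑ ij ∈ Finset.HasAntidiagonal.antidiagonal N, (N.choose ij.1 : ℝ) * ij.1.descFactorial n * D ij.1 ij.2 =
        N.descFactorial n * D n 0 := by
  induction n with
  | zero =>
    intro D h N
    simp [eq_sum_antidiagonal_choose_mul h N 0 0]
  | succ n ih =>
    intro D h N
    rcases N with _ | N
    · simp
    · rw [Finset.Nat.sum_antidiagonal_succ, Nat.succ_descFactorial_succ, Nat.cast_mul,
        mul_assoc ((N + 1 : ℕ) : ℝ), ← ih (D := fun n k => D (n + 1) k) (fun n k => h (n + 1) k) N, Finset.mul_sum]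
      simp only [Nat.zero_descFactorial_succ, Nat.cast_zero, mul_zero, zero_mul, zero_add]
      refine Finset.sum_congr rfl fun ij _ => ?_
      have := congrArg (Nat.cast (R := ℝ)) (Nat.add_one_mul_choose_eq N ij.1)
      push_cast [Nat.succ_descFactorial_succ] at this ⊢
      linear_combination (-(ij.1.descFactorial n : ℝ) * D (ij.1 + 1) ij.2) * this

/-- The discrete measures of Bernstein type approximating the solution of the moment problem. -/
noncomputable def bernsteinMeasure (D : ℕ → ℕ → ℝ) (N : ℕ) : Measure unitInterval :=
  ∑ ij ∈ Finset.HasAntidiagonal.antidiagonal N, ENNReal.ofReal ((N.choose ij.1 : ℝ) * D ij.1 ij.2) •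
    Measure.dirac (projIcc (0 : ℝ) 1 zero_le_one (ij.1 / N))

instance (D : ℕ → ℕ → ℝ) (N : ℕ) : IsFiniteMeasure (bernsteinMeasure D N) := by
  refine ⟨?_⟩
  simp [bernsteinMeasure, ENNReal.sum_lt_top, ENNReal.mul_lt_top]

lemma integral_bernsteinMeasure (hD : ∀ n k, 0 ≤ D n k) (N : ℕ) (g : C(unitInterval, ℝ)) :
    ∫ s, g s ∂(bernsteinMeasure D N) = ∑ ij ∈ Finset.HasAntidiagonal.antidiagonal N,
      (N.choose ij.1 : ℝ) * D ij.1 ij.2 * g (projIcc (0 : ℝ) 1 zero_le_one (ij.1 / N)) := by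
  rw [bernsteinMeasure, integral_finsetSum_measure]
  · refine Finset.sum_congr rfl fun ij _ => ?_
    rw [integral_smul_measure, integral_dirac,
      ENNReal.toReal_ofReal (mul_nonneg (by positivity) (hD _ _)), smul_eq_mul]
  · intro ij _
    exact (integrable_dirac (by simp)).smul_measure ENNReal.ofReal_ne_top

lemma abs_integral_bernsteinMeasure_sub_le (hD : ∀ n k, 0 ≤ D n k)
    (h : ∀ n k, D n k = D (n + 1) k + D n (k + 1)) (n : ℕ) {N : ℕ} (hN : 0 < N) :
    |∫ s, (s : ℝ) ^ n ∂(bernsteinMeasure D N) - D n 0| ≤ n ^ 2 * (D 0 0 + D n 0) / N := by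
  have hN' : (0 : ℝ) < N := by exact_mod_cast hN
  have hint := integral_bernsteinMeasure hD N ⟨fun s => (s : ℝ) ^ n, by fun_prop⟩
  simp only [ContinuousMap.coe_mk] at hint
  have hint2 : (∫ s, (s : ℝ) ^ n ∂(bernsteinMeasure D N)) * (N : ℝ) ^ n =
      ∑ ij ∈ Finset.HasAntidiagonal.antidiagonal N, (N.choose ij.1 : ℝ) * D ij.1 ij.2 * (ij.1 : ℝ) ^ n := by
    rw [hint, Finset.sum_mul]
    refine Finset.sum_congr rfl fun ij hij => ?_
    have hle : (ij.1 : ℝ) ≤ N := by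
      exact_mod_cast (Finset.HasAntidiagonal.mem_antidiagonal.1 hij).symm ▸ Nat.le_add_right _ _
    rw [projIcc_of_mem zero_le_one ⟨by positivity, (div_le_one hN').2 hle⟩, div_pow]
    field_simp
  have h0 := eq_sum_antidiagonal_choose_mul h N 0 0
  simp only [zero_add] at h0
  have hdesc := sum_antidiagonal_choose_mul_descFactorial_mul n h N
  have hkey : |(∫ s, (s : ℝ) ^ n ∂(bernsteinMeasure D N)) * (N : ℝ) ^ n -
      N.descFactorial n * D n 0| * N ≤ n ^ 2 * (N : ℝ) ^ n * D 0 0 := by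
    rw [hint2, ← hdesc, ← Finset.sum_sub_distrib]
    refine (mul_le_mul_of_nonneg_right (Finset.abs_sum_le_sum_abs _ _) hN'.le).trans ?_
    rw [h0, Finset.sum_mul, Finset.mul_sum]
    refine Finset.sum_le_sum fun ij hij => ?_
    have hb := abs_pow_sub_descFactorial_mul_le 
      ((Finset.HasAntidiagonal.mem_antidiagonal.1 hij).symm ▸ Nat.le_add_right _ _ : ij.1 ≤ N) n
    have hc : 0 ≤ (N.choose ij.1 : ℝ) * D ij.1 ij.2 := mul_nonneg (by positivity) (hD _ _)
    have e : (N.choose ij.1 : ℝ) * D ij.1 ij.2 * (ij.1 : ℝ) ^ n -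
        (N.choose ij.1 : ℝ) * ij.1.descFactorial n * D ij.1 ij.2 =
        (N.choose ij.1 : ℝ) * D ij.1 ij.2 * ((ij.1 : ℝ) ^ n - ij.1.descFactorial n) := by ring
    rw [e, abs_mul, abs_of_nonneg hc, mul_assoc]
    exact (mul_le_mul_of_nonneg_left hb hc).trans (le_of_eq (by ring))
  have hN2 := abs_pow_sub_descFactorial_mul_le le_rfl n (i := N)
  have hp : 0 < (N : ℝ) ^ n := by positivity
  rw [le_div_iff₀ hN']
  refine le_of_mul_le_mul_right ?_ hp
  set J := ∫ s, (s : ℝ) ^ n ∂(bernsteinMeasure D N)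
  have e1 : (J - D n 0) * (N : ℝ) ^ n = (J * (N : ℝ) ^ n - N.descFactorial n * D n 0) +
      -(((N : ℝ) ^ n - N.descFactorial n) * D n 0) := by ring
  calc |J - D n 0| * N * (N : ℝ) ^ n = |(J - D n 0) * (N : ℝ) ^ n| * N := by
        rw [abs_mul, abs_of_pos hp]; ring
    _ ≤ (|J * (N : ℝ) ^ n - N.descFactorial n * D n 0| +
        |(N : ℝ) ^ n - N.descFactorial n| * D n 0) * N := by
        rw [e1]
        refine mul_le_mul_of_nonneg_right ((abs_add_le _ _).trans (le_of_eq ?_)) hN'.le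
        rw [abs_neg, abs_mul, abs_of_nonneg (hD n 0)]
    _ ≤ n ^ 2 * (N : ℝ) ^ n * D 0 0 + n ^ 2 * (N : ℝ) ^ n * D n 0 := by
        have := mul_le_mul_of_nonneg_right hN2 (hD n 0)
        linarith
    _ = n ^ 2 * (D 0 0 + D n 0) * (N : ℝ) ^ n := by ring

/-- The Hausdorff moment problem: a completely monotone sequence, given together with its table of
differences `D n k`, is the moment sequence of a finite measure on the unit interval. -/
theorem exists_measure_integral_pow_eq (hD : ∀ n k, 0 ≤ D n k)
    (h : ∀ n k, D n k = D (n + 1) k + D n (k + 1)) :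
    ∃ σ : Measure unitInterval, IsFiniteMeasure σ ∧ ∀ n, ∫ s, (s : ℝ) ^ n ∂σ = D n 0 := by
  let u : ℕ → FiniteMeasure unitInterval := fun N => ⟨bernsteinMeasure D N, inferInstance⟩
  have hu : ∀ N, u N ∈ {μ : FiniteMeasure unitInterval | μ.mass ≤ (D 0 0).toNNReal} := by
    intro N
    have h1 := integral_bernsteinMeasure hD N ⟨fun _ => 1, by fun_prop⟩
    have h0 := eq_sum_antidiagonal_choose_mul h N 0 0
    simp only [zero_add] at h0
    simp only [ContinuousMap.coe_mk, mul_one, integral_const, smul_eq_mul, ← h0] at h1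
    change (u N).mass ≤ _
    rw [← NNReal.coe_le_coe, Real.coe_toNNReal _ (hD 0 0)]
    exact h1.le
  obtain ⟨σ, -, hσ⟩ := (isCompact_setOfPred_finiteMeasure_le_of_compactSpace unitInterval
    (D 0 0).toNNReal).ultrafilter_le_nhds ((hyperfilter ℕ).map u)
    (le_principal_iff.2 (Ultrafilter.mem_map.2 (Eventually.of_forall hu)))
  refine ⟨σ, inferInstance, fun n => ?_⟩
  have ht : Tendsto u (hyperfilter ℕ) (nhds σ) := hσ
  have h1 := FiniteMeasure.tendsto_iff_forall_integral_tendsto.1 ht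
    (BoundedContinuousFunction.mkOfCompact ⟨fun s => (s : ℝ) ^ n, by fun_prop⟩)
  have h2 : Tendsto (fun N => ∫ s, (s : ℝ) ^ n ∂(bernsteinMeasure D N)) atTop (nhds (D n 0)) := by
    rw [tendsto_iff_norm_sub_tendsto_zero]
    refine squeeze_zero' (Eventually.of_forall fun _ => norm_nonneg _) ?_
      (tendsto_const_div_atTop_nhds_zero_nat (n ^ 2 * (D 0 0 + D n 0)))
    filter_upwards [eventually_gt_atTop 0] with N hN
      using abs_integral_bernsteinMeasure_sub_le hD h n hN
  exact tendsto_nhds_unique h1 (h2.mono_left Nat.hyperfilter_le_atTop)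

end HausdorffMoment

section StieltjesChain

variable {ρ : Measure ℝ}

lemma integrable_pow_mul_inv_pow (hρ : ∀ᵐ t ∂ρ, 0 ≤ t)
    (hi : ∀ x > (0 : ℝ), Integrable (fun t => (x + t)⁻¹) ρ) {x : ℝ} (hx : 0 < x) (n k : ℕ) :
    Integrable (fun t => t ^ k * (x + t)⁻¹ ^ (n + k + 1)) ρ := by
  refine ((hi x hx).const_mul (x⁻¹ ^ n)).mono' (by fun_prop) ?_
  filter_upwards [hρ] with t ht
  have hxt : 0 < x + t := by linarith
  have h1 : (t * (x + t)⁻¹) ^ k ≤ 1 := by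
    refine pow_le_one₀ (by positivity) ?_
    rw [← div_eq_mul_inv, div_le_one hxt]
    linarith
  have h2 : (x + t)⁻¹ ^ n ≤ x⁻¹ ^ n := by gcongr; linarith
  rw [Real.norm_of_nonneg (by positivity)]
  calc t ^ k * (x + t)⁻¹ ^ (n + k + 1)
      = (t * (x + t)⁻¹) ^ k * ((x + t)⁻¹ ^ n * (x + t)⁻¹) := by rw [mul_pow]; ring
    _ ≤ 1 * (x⁻¹ ^ n * (x + t)⁻¹) := by gcongr
    _ = x⁻¹ ^ n * (x + t)⁻¹ := one_mul _

lemma integrable_inv_pow (hρ : ∀ᵐ t ∂ρ, 0 ≤ t)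
    (hi : ∀ x > (0 : ℝ), Integrable (fun t => (x + t)⁻¹) ρ) {x : ℝ} (hx : 0 < x) (n : ℕ) :
    Integrable (fun t => (x + t)⁻¹ ^ (n + 1)) ρ := by
  simpa using integrable_pow_mul_inv_pow hρ hi hx n 0

lemma hasDerivAt_integral_inv_pow (hρ : ∀ᵐ t ∂ρ, 0 ≤ t)
    (hi : ∀ x > (0 : ℝ), Integrable (fun t => (x + t)⁻¹) ρ) {x : ℝ} (hx : 0 < x) (n : ℕ) :
    HasDerivAt (fun x => ∫ t, (x + t)⁻¹ ^ (n + 1) ∂ρ)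
      (-((n + 1) * ∫ t, (x + t)⁻¹ ^ (n + 2) ∂ρ)) x := by
  have hx2 : 0 < x / 2 := half_pos hx
  have := (hasDerivAt_integral_of_dominated_loc_of_deriv_le (μ := ρ) (s := Ioi (x / 2)) (x₀ := x)
    (F := fun x t => (x + t)⁻¹ ^ (n + 1)) (F' := fun x t => -((n + 1) * (x + t)⁻¹ ^ (n + 2)))
    (bound := fun t => (n + 1) * (x / 2 + t)⁻¹ ^ (n + 2)) (Ioi_mem_nhds (half_lt_self hx))
    (Eventually.of_forall fun y => by fun_prop) (integrable_inv_pow hρ hi hx n) (by fun_prop) ?_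
    ((integrable_inv_pow hρ hi hx2 (n + 1)).const_mul _) ?_).2
  · rwa [integral_neg, integral_const_mul] at this
  · filter_upwards [hρ] with t ht y hy
    have hy : x / 2 < y := hy
    have hyt : 0 < y + t := by linarith
    rw [norm_neg, Real.norm_of_nonneg (by positivity)]
    gcongr
  · filter_upwards [hρ] with t ht y hy
    have hy : x / 2 < y := hy
    have hyt : y + t ≠ 0 := by linarith
    refine ((((hasDerivAt_id y).add_const t).inv hyt).pow (n + 1)).congr_deriv ?_
    simp
    field_simp
    ring

/-- The successive derivatives of the Stieltjes function `x ↦ C + ∫ (x + t)⁻¹ ∂ρ`. -/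
noncomputable def stieltjesChain (C : ℝ) (ρ : Measure ℝ) (n : ℕ) (x : ℝ) : ℝ :=
  (if n = 0 then C else 0) + (-1) ^ n * n.factorial * ∫ t, (x + t)⁻¹ ^ (n + 1) ∂ρ

lemma isDerivChain_stieltjesChain (C : ℝ) (hρ : ∀ᵐ t ∂ρ, 0 ≤ t)
    (hi : ∀ x > (0 : ℝ), Integrable (fun t => (x + t)⁻¹) ρ) :
    IsDerivChain (stieltjesChain C ρ) := by
  intro n x hx
  refine (((hasDerivAt_integral_inv_pow hρ hi hx n).const_mul
    ((-1) ^ n * (n.factorial : ℝ))).const_add _).congr_deriv ?_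
  rw [stieltjesChain, Nat.factorial_succ]
  push_cast
  simp
  ring

lemma chainF_stieltjesChain (C : ℝ) (hρ : ∀ᵐ t ∂ρ, 0 ≤ t)
    (hi : ∀ x > (0 : ℝ), Integrable (fun t => (x + t)⁻¹) ρ) {x : ℝ} (hx : 0 < x) (n k : ℕ) :
    chainF (stieltjesChain C ρ) n k x = (if n = 0 then k.factorial * C else 0) +
      (n + k).factorial * ∫ t, t ^ k * (x + t)⁻¹ ^ (n + k + 1) ∂ρ := by
  induction k generalizing n with
  | zero =>
    rw [chainF_zero_right, stieltjesChain]
    have : (-1 : ℝ) ^ n * (-1) ^ n = 1 := by rw [← mul_pow]; simp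
    rcases n with _ | n
    · simp
    · simp only [Nat.add_eq_zero_iff, one_ne_zero, and_false, ite_false, zero_add, pow_zero,
        one_mul, add_zero]
      linear_combination (((n + 1).factorial : ℝ) * ∫ t, (x + t)⁻¹ ^ (n + 1 + 1) ∂ρ) * this
  | succ k ih =>
    have key : ∫ t, t ^ (k + 1) * (x + t)⁻¹ ^ (n + (k + 1) + 1) ∂ρ =
        (∫ t, t ^ k * (x + t)⁻¹ ^ (n + k + 1) ∂ρ) -
          x * ∫ t, t ^ k * (x + t)⁻¹ ^ (n + 1 + k + 1) ∂ρ := by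
      rw [← integral_const_mul, ← integral_sub (integrable_pow_mul_inv_pow hρ hi hx n k)
        ((integrable_pow_mul_inv_pow hρ hi hx (n + 1) k).const_mul x)]
      refine integral_congr_ae ?_
      filter_upwards [hρ] with t ht
      have hxt : x + t ≠ 0 := by linarith
      have h1 : (x + t)⁻¹ ^ (n + k + 1) = (x + t)⁻¹ ^ (n + k + 2) * (x + t) := by
        rw [pow_succ _ (n + k + 1), mul_assoc, inv_mul_cancel₀ hxt, mul_one]
      rw [h1]
      ring
    rw [chainF_succ_right, ih, ih, key, ← add_assoc n k 1, Nat.factorial_succ (n + k),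
      Nat.factorial_succ k, show n + 1 + k = n + k + 1 by ring, Nat.factorial_succ (n + k)]
    rcases n with _ | n
    · simp
      ring
    · simp
      ring

lemma chainF_stieltjesChain_nonneg {C : ℝ} (hC : 0 ≤ C) (hρ : ∀ᵐ t ∂ρ, 0 ≤ t)
    (hi : ∀ x > (0 : ℝ), Integrable (fun t => (x + t)⁻¹) ρ) {x : ℝ} (hx : 0 < x) (n k : ℕ) :
    0 ≤ chainF (stieltjesChain C ρ) n k x := by
  rw [chainF_stieltjesChain C hρ hi hx]
  have h1 : 0 ≤ ∫ t, t ^ k * (x + t)⁻¹ ^ (n + k + 1) ∂ρ := by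
    refine integral_nonneg_of_ae ?_
    filter_upwards [hρ] with t ht
    have : 0 < x + t := by linarith
    change (0 : ℝ) ≤ _
    positivity
  split_ifs <;> positivity

end StieltjesChain

section ChangeOfVariables

/-- The image of `s⁻¹ ∂σ` on `(0,1]` under `s ↦ s⁻¹ - 1`. -/
noncomputable def stieltjesMeasure (σ : Measure unitInterval) : Measure ℝ :=
  ((σ.restrict {0}ᶜ).withDensity fun s => ENNReal.ofReal (s : ℝ)⁻¹).map fun s : unitInterval => (s : ℝ)⁻¹ - 1

variable (σ : Measure unitInterval)

lemma ae_nonneg_stieltjesMeasure : ∀ᵐ t ∂(stieltjesMeasure σ), 0 ≤ t := by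
  refine (ae_map_iff (by fun_prop) measurableSet_Ici).2 ?_
  refine (withDensity_absolutelyContinuous _ _).ae_le ?_
  filter_upwards [ae_restrict_mem (measurableSet_singleton 0).compl] with s hs
  have h0 : 0 < (s : ℝ) := lt_of_le_of_ne s.2.1 fun h => hs (Subtype.ext h.symm)
  have := (one_le_inv₀ h0).2 s.2.2
  linarith

lemma integral_stieltjesMeasure {g : ℝ → ℝ} (hg : Measurable g) :
    ∫ t, g t ∂(stieltjesMeasure σ) = ∫ s in {0}ᶜ, (s : ℝ)⁻¹ * g ((s : ℝ)⁻¹ - 1) ∂σ := by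
  rw [stieltjesMeasure, integral_map (by fun_prop) hg.aestronglyMeasurable,
    integral_withDensity_eq_integral_toReal_smul (by fun_prop) (by simp)]
  refine integral_congr_ae (Eventually.of_forall fun s => ?_)
  simp only [smul_eq_mul]
  rw [ENNReal.toReal_ofReal (inv_nonneg.2 s.2.1)]

lemma integrable_inv_stieltjesMeasure [IsFiniteMeasure σ] {x : ℝ} (hx : 0 < x) :
    Integrable (fun t => (x + t)⁻¹) (stieltjesMeasure σ) := by
  rw [stieltjesMeasure, integrable_map_measure (by fun_prop) (by fun_prop),
    integrable_withDensity_iff_integrable_smul' (by fun_prop) (by simp)]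
  refine Integrable.of_bound (by fun_prop) (min 1 x)⁻¹ ?_
  filter_upwards [ae_restrict_mem (measurableSet_singleton 0).compl] with s hs
  have h0 : 0 < (s : ℝ) := lt_of_le_of_ne s.2.1 fun h => hs (Subtype.ext h.symm)
  have h1 : (s : ℝ) ≤ 1 := s.2.2
  have hm : 0 < min 1 x := lt_min one_pos hx
  have hle : min 1 x ≤ 1 - s + x * s := by
    nlinarith [min_le_left 1 x, min_le_right 1 x]
  have e : (s : ℝ)⁻¹ * (x + ((s : ℝ)⁻¹ - 1))⁻¹ = (1 - s + x * s)⁻¹ := by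
    rw [← mul_inv]
    congr 1
    field_simp
    ring
  simp only [Function.comp_apply, smul_eq_mul]
  rw [ENNReal.toReal_ofReal (inv_nonneg.2 s.2.1), e,
    Real.norm_of_nonneg (inv_nonneg.2 (hm.le.trans hle))]
  exact inv_anti₀ hm hle

lemma integral_pow_eq_stieltjesMeasure [IsFiniteMeasure σ] (n : ℕ) :
    ∫ s, (s : ℝ) ^ n ∂σ = (if n = 0 then σ.real {0} else 0) +
      ∫ t, (1 + t)⁻¹ ^ (n + 1) ∂(stieltjesMeasure σ) := by
  have hint : Integrable (fun s : unitInterval => (s : ℝ) ^ n) σ := by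
    refine Integrable.of_bound (by fun_prop) 1 (Eventually.of_forall fun s => ?_)
    rw [Real.norm_of_nonneg (pow_nonneg s.2.1 n)]
    exact pow_le_one₀ s.2.1 s.2.2
  rw [← integral_add_compl (measurableSet_singleton 0) hint,
    integral_stieltjesMeasure σ (by fun_prop)]
  congr 1
  · rw [integral_singleton]
    rcases n with _ | n <;> simp
  · refine setIntegral_congr_fun (measurableSet_singleton 0).compl fun s hs => ?_
    have h0 : (s : ℝ) ≠ 0 := fun h => hs (Subtype.ext h)
    simp only [add_sub_cancel, inv_inv]
    field_simp
    ring

end ChangeOfVariables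

/-- A function with all `F_{n,k}` nonnegative is a Stieltjes function. -/
lemma IsDerivChain.exists_stieltjesMeasure_eq {a : ℕ → ℝ → ℝ} (ha : IsDerivChain a)
    (h : ∀ n k, ∀ x > 0, 0 ≤ chainF a n k x) :
    ∃ σ : Measure unitInterval, IsFiniteMeasure σ ∧
      ∀ x > 0, a 0 x = stieltjesChain (σ.real {0}) (stieltjesMeasure σ) 0 x := by
  obtain ⟨σ, hfin, hσ⟩ := exists_measure_integral_pow_eq
    (D := fun n k => chainF a n k 1 / (n + k).factorial)
    (fun n k => div_nonneg (h n k 1 one_pos) (by positivity)) fun n k => by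
      rw [chainF_succ_right, ← add_assoc, show n + 1 + k = n + k + 1 by ring, Nat.factorial_succ]
      push_cast
      have h1 : (n + k + 1 : ℝ) ≠ 0 := by positivity
      have h2 : ((n + k).factorial : ℝ) ≠ 0 := by positivity
      field_simp
      ring
  have hρ := ae_nonneg_stieltjesMeasure σ
  have hi : ∀ x > (0 : ℝ), Integrable (fun t => (x + t)⁻¹) (stieltjesMeasure σ) :=
    fun x hx => integrable_inv_stieltjesMeasure σ hx
  refine ⟨σ, hfin, fun x hx => ha.eq_of_forall_eq (isDerivChain_stieltjesChain _ hρ hi)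
    (fun n y hy => h n 0 y hy)
    (fun n y hy => chainF_stieltjesChain_nonneg measureReal_nonneg hρ hi hy n 0) one_pos
    (fun n => ?_) hx⟩
  have h1 := hσ n
  rw [integral_pow_eq_stieltjesMeasure, chainF_zero_right, add_zero] at h1
  have hf : (n.factorial : ℝ) ≠ 0 := by positivity
  have hs : (-1 : ℝ) ^ n * (-1) ^ n = 1 := by rw [← mul_pow]; simp
  rw [eq_div_iff hf] at h1
  rw [stieltjesChain]
  rcases n with _ | n
  · simp only [pow_zero, Nat.factorial_zero, Nat.cast_one, one_mul, mul_one, ite_true] at h1 ⊢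
    exact h1.symm
  · simp only [Nat.add_eq_zero_iff, one_ne_zero, and_false, ite_false, zero_add] at h1 ⊢
    linear_combination (-a (n + 1) 1) * hs - (-1 : ℝ) ^ (n + 1) * h1

/-- `f` is a Stieltjes function iff `f` is `C^∞` on `(0,∞)`,
`F_{0,0}(x) ≥ 0` for all `x > 0`, and `F_{k−1,k}(x) ≥ 0` for all `k ≥ 1` and `x > 0`. -/
theorem stmt4 (f : ℝ → ℝ) :
    IsStieltjes f ↔
      (ContDiffOn ℝ (⊤ : ℕ∞) f (Set.Ioi 0) ∧
        (∀ x > (0 : ℝ), 0 ≤ Fst f 0 0 x) ∧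
        ∀ k : ℕ, 1 ≤ k → ∀ x > (0 : ℝ), 0 ≤ Fst f (k - 1) k x) := by
  constructor
  · rintro ⟨C, ρ, hC, hρ, hint, hf⟩
    have hρ' : ∀ᵐ t ∂ρ, 0 ≤ t := by
      rw [ae_iff]
      simpa [Set.Iio] using hρ
    simp only [Real.rpow_neg_one] at hint hf
    have hchain := isDerivChain_stieltjesChain C hρ' hint
    have hf0 : ∀ x > 0, f x = stieltjesChain C ρ 0 x := fun x hx => by
      simpa [stieltjesChain] using hf x hx
    have hF : ∀ n k, ∀ x > 0, 0 ≤ Fst f n k x := fun n k x hx => by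
      have := chainF_stieltjesChain_nonneg hC hρ' hint hx n k
      rw [chainF_eq_sum] at this
      rw [Fst]
      simpa only [hchain.iteratedDerivWithin_eq hf0 _ x hx] using this
    exact ⟨hchain.contDiffOn hf0, hF 0 0, fun k _ => hF (k - 1) k⟩
  · rintro ⟨hf, h0, h⟩
    have ha := IsDerivChain.of_contDiffOn hf
    simp only [Fst_eq_chainF] at h0 h
    have hall := ha.chainF_nonneg (by simpa [chainF_zero_right] using h0)
      (fun k => by simpa using h (k + 1) (by omega))
    obtain ⟨σ, hfin, hσ⟩ := ha.exists_stieltjesMeasure_eq hall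
    refine ⟨σ.real {0}, stieltjesMeasure σ, measureReal_nonneg, ?_, fun x hx => ?_, fun x hx => ?_⟩
    · simpa [ae_iff, Set.Iio] using ae_nonneg_stieltjesMeasure σ
    · simpa only [Real.rpow_neg_one] using integrable_inv_stieltjesMeasure σ hx
    · simpa [stieltjesChain, Real.rpow_neg_one] using hσ x hx
end
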